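/- (Second-derivative expansion.) (1) Let N ≥ 3 and let x = x_ε ∈ Ω_ε satisfy C_1 ε^β ≤ |x−P| ≤ C_2 ε^β for some constants C_1, C_2 > 0 and β ∈ (0,(N−1)/N). Then for all i,j: ∂²u_ε(x)/∂x_i∂x_j = ∂²u_0(x)/∂x_i∂x_j + o(1) + ((N−2)u_0(P) ε^{N−2}/|x−P|^N)(δ_ij − N(x_i−P_i)(x_j−P_j)/|x−P|² + o(1)). (2) Let N = 2 and let x = x_ε satisfy C_1/|log ε|^δ ≤ |x−P| ≤ C_2/|log ε|^δ for some C_1, C_2, δ > 0. Then ∂²u_ε(x)/∂x_i∂x_j = ∂²u_0(x)/∂x_i∂x_j + o(1) + (u_0(P)/(|log ε| |x−P|²))(δ_ij − 2(x_i−P_i)(x_j−P_j)/|x−P|² + o(1/|x−P|)). -/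

import Mathlib

open Filter Set Topology Metric MeasureTheory

noncomputable section

/-- Euclidean space `ℝ^N`. -/
abbrev EN (N : ℕ) := EuclideanSpace ℝ (Fin N)

/-- Partial derivative `∂u/∂x_i`. -/
def pd {N : ℕ} (u : EN N → ℝ) (i : Fin N) (x : EN N) : ℝ :=
  fderiv ℝ u x (EuclideanSpace.single i 1)

/-- Second partial derivative `∂²u/∂x_i∂x_j`. -/
def pd2 {N : ℕ} (u : EN N → ℝ) (i j : Fin N) (x : EN N) : ℝ :=
  fderiv ℝ (fun y => pd u i y) x (EuclideanSpace.single j 1)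

/-- The Laplacian `Δu`. -/
def lap {N : ℕ} (u : EN N → ℝ) (x : EN N) : ℝ := ∑ i, pd2 u i i x

/-- The Hessian matrix of `u` at `x`. -/
def hess {N : ℕ} (u : EN N → ℝ) (x : EN N) : Matrix (Fin N) (Fin N) ℝ :=
  Matrix.of fun i j => pd2 u i j x

/-- `u` is a (classical, positive) solution of `-Δu = f(u)` in `D`, `u > 0` in `D`,
`u = 0` on `∂D`. -/
def IsSol {N : ℕ} (f : ℝ → ℝ) (D : Set (EN N)) (u : EN N → ℝ) : Prop :=
  ContDiffOn ℝ 2 u D ∧ (∀ x ∈ D, lap u x = - f (u x)) ∧ (∀ x ∈ D, 0 < u x) ∧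
    ContinuousOn u (closure D) ∧ (∀ x ∈ frontier D, u x = 0)

/-- `u ε → u₀` in `C²(K)` as `ε → 0⁺`: uniform convergence on `K` of the functions and of
their first and second partial derivatives. -/
def C2ConvOn {N : ℕ} (u : ℝ → EN N → ℝ) (u₀ : EN N → ℝ) (K : Set (EN N)) : Prop :=
  TendstoUniformlyOn (fun ε => u ε) u₀ (𝓝[>] (0:ℝ)) K ∧
    (∀ i, TendstoUniformlyOn (fun ε => pd (u ε) i) (pd u₀ i) (𝓝[>] (0:ℝ)) K) ∧
    (∀ i j, TendstoUniformlyOn (fun ε => pd2 (u ε) i j) (pd2 u₀ i j) (𝓝[>] (0:ℝ)) K)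

/-- The common setting of the paper: `Ω` a bounded domain, `P ∈ Ω`, `f` smooth, and for every
small `ε > 0`, `u ε` solves `-Δu = f(u)`, `u > 0` in `Ω_ε = Ω \ B(P,ε)`, `u = 0` on `∂Ω_ε`,
with a uniform bound `|u ε| ≤ C`, and `u₀` is the weak limit: a solution on `Ω` such that
`u ε → u₀` in `C²(K)` for every compact `K ⊆ Ω \ {P}`. -/
def Setting {N : ℕ} (Ω : Set (EN N)) (P : EN N) (f : ℝ → ℝ) (ε₀ C : ℝ)
    (u : ℝ → EN N → ℝ) (u₀ : EN N → ℝ) : Prop :=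
  IsOpen Ω ∧ Bornology.IsBounded Ω ∧ P ∈ Ω ∧ ContDiff ℝ (⊤ : ℕ∞) f ∧ 0 < ε₀ ∧
    (∀ ε ∈ Ioo (0:ℝ) ε₀, IsSol f (Ω \ closedBall P ε) (u ε)) ∧
    (∀ ε ∈ Ioo (0:ℝ) ε₀, ∀ x ∈ Ω \ closedBall P ε, |u ε x| ≤ C) ∧
    IsSol f Ω u₀ ∧
    (∀ K ⊆ Ω \ {P}, IsCompact K → C2ConvOn u u₀ K)

section PartialDerivatives

variable {N : ℕ}

theorem pd_congr {u v : EN N → ℝ} {x : EN N} (h : u =ᶠ[𝓝 x] v) (i : Fin N) :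
    pd u i x = pd v i x := by
  simp only [pd, h.fderiv_eq]

theorem pd_eventuallyEq {u v : EN N → ℝ} {x : EN N} (h : u =ᶠ[𝓝 x] v) (i : Fin N) :
    pd u i =ᶠ[𝓝 x] pd v i := by
  filter_upwards [h.eventuallyEq_nhds] with y hy using pd_congr hy i

theorem pd2_congr {u v : EN N → ℝ} {x : EN N} (h : u =ᶠ[𝓝 x] v) (i j : Fin N) :
    pd2 u i j x = pd2 v i j x :=
  pd_congr (pd_eventuallyEq h i) j

theorem pd_of_hasFDerivAt {u : EN N → ℝ} {u' : EN N →L[ℝ] ℝ} {x : EN N}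
    (h : HasFDerivAt u u' x) (i : Fin N) : pd u i x = u' (EuclideanSpace.single i 1) := by
  rw [pd, h.fderiv]

theorem pd_add {u v : EN N → ℝ} {x : EN N} (hu : DifferentiableAt ℝ u x)
    (hv : DifferentiableAt ℝ v x) (i : Fin N) :
    pd (fun y => u y + v y) i x = pd u i x + pd v i x := by
  rw [pd_of_hasFDerivAt (hu.hasFDerivAt.fun_add hv.hasFDerivAt)]; rfl

theorem pd_sub {u v : EN N → ℝ} {x : EN N} (hu : DifferentiableAt ℝ u x)
    (hv : DifferentiableAt ℝ v x) (i : Fin N) :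
    pd (fun y => u y - v y) i x = pd u i x - pd v i x := by
  rw [pd_of_hasFDerivAt (hu.hasFDerivAt.fun_sub hv.hasFDerivAt)]; rfl

theorem pd_mul {u v : EN N → ℝ} {x : EN N} (hu : DifferentiableAt ℝ u x)
    (hv : DifferentiableAt ℝ v x) (i : Fin N) :
    pd (fun y => u y * v y) i x = u x * pd v i x + v x * pd u i x := by
  rw [pd_of_hasFDerivAt (hu.hasFDerivAt.fun_mul hv.hasFDerivAt)]; rfl

theorem pd_const (c : ℝ) (i : Fin N) (x : EN N) : pd (fun _ => c) i x = 0 := by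
  simp [pd]

theorem pd_const_mul {u : EN N → ℝ} {x : EN N} (hu : DifferentiableAt ℝ u x) (c : ℝ)
    (i : Fin N) : pd (fun y => c * u y) i x = c * pd u i x := by
  rw [pd_of_hasFDerivAt (hu.hasFDerivAt.const_mul c)]; rfl

theorem pd_comp {g : ℝ → ℝ} {u : EN N → ℝ} {x : EN N} (hg : DifferentiableAt ℝ g (u x))
    (hu : DifferentiableAt ℝ u x) (i : Fin N) :
    pd (fun y => g (u y)) i x = deriv g (u x) * pd u i x := by
  exact pd_of_hasFDerivAt (hg.hasDerivAt.comp_hasFDerivAt x hu.hasFDerivAt) i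

theorem pd_comp_smul_sub (u : EN N → ℝ) (c : ℝ) (P : EN N) (i : Fin N) (x : EN N)
    (hu : DifferentiableAt ℝ u (c • (x - P))) :
    pd (fun y => u (c • (y - P))) i x = c * pd u i (c • (x - P)) := by
  have h1 : HasFDerivAt (fun y : EN N => c • (y - P)) (c • ContinuousLinearMap.id ℝ (EN N)) x :=
    ((hasFDerivAt_id x).sub_const P).const_smul c
  refine (pd_of_hasFDerivAt (hu.hasFDerivAt.comp x h1) i).trans ?_
  simp [pd]

theorem pd_const_sub (u : EN N → ℝ) (x : EN N) (i : Fin N) (y : EN N)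
    (hu : DifferentiableAt ℝ u (x - y)) :
    pd (fun z => u (x - z)) i y = - pd u i (x - y) := by
  have h1 : HasFDerivAt (fun z : EN N => x - z) (-ContinuousLinearMap.id ℝ (EN N)) y :=
    (hasFDerivAt_id y).const_sub x
  refine (pd_of_hasFDerivAt (hu.hasFDerivAt.comp y h1) i).trans ?_
  simp [pd]

theorem ContDiffAt.pd {u : EN N → ℝ} {x : EN N} {m n : WithTop ℕ∞} (hu : ContDiffAt ℝ n u x)
    (hmn : m + 1 ≤ n) (i : Fin N) : ContDiffAt ℝ m (pd u i) x :=
  (hu.fderiv_right hmn).clm_apply contDiffAt_const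

theorem ContDiffAt.pd_one {u : EN N → ℝ} {x : EN N} (hu : ContDiffAt ℝ 2 u x)
    (i : Fin N) : ContDiffAt ℝ 1 (_root_.pd u i) x :=
  hu.pd (by norm_num) i

theorem pd2_comm {u : EN N → ℝ} {x : EN N} (hu : ContDiffAt ℝ 2 u x) (i j : Fin N) :
    pd2 u i j x = pd2 u j i x := by
  have h := hu.isSymmSndFDerivAt (by simp)
  have hd : DifferentiableAt ℝ (fderiv ℝ u) x :=
    (hu.fderiv_right (m := 1) (by norm_num)).differentiableAt (by norm_num)
  have key : ∀ i j : Fin N, pd2 u i j x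
      = fderiv ℝ (fderiv ℝ u) x (EuclideanSpace.single j 1) (EuclideanSpace.single i 1) := by
    intro i j
    have := hd.hasFDerivAt.clm_apply (hasFDerivAt_const (EuclideanSpace.single i (1:ℝ)) x)
    rw [pd2]
    simp only [pd]
    rw [this.fderiv]
    simp
  rw [key, key, h.eq]

theorem pd_eq_zero_of_eventuallyEq_const {u : EN N → ℝ} {x : EN N} {c : ℝ}
    (h : u =ᶠ[𝓝 x] fun _ => c) (i : Fin N) : pd u i x = 0 := by
  rw [pd_congr h, pd_const]

theorem pd_support_subset (u : EN N → ℝ) (i : Fin N) :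
    Function.support (pd u i) ⊆ tsupport u := by
  intro x hx
  by_contra hx'
  exact hx (pd_eq_zero_of_eventuallyEq_const (notMem_tsupport_iff_eventuallyEq.1 hx') i)

theorem HasCompactSupport.pd {u : EN N → ℝ} (hu : HasCompactSupport u) (i : Fin N) :
    HasCompactSupport (pd u i) :=
  hu.mono' (pd_support_subset u i)

theorem abs_pd_le (u : EN N → ℝ) (i : Fin N) (x : EN N) : |pd u i x| ≤ ‖fderiv ℝ u x‖ := by
  have := (fderiv ℝ u x).le_opNorm (EuclideanSpace.single i 1)
  simpa [pd] using this

theorem lap_congr {u v : EN N → ℝ} {x : EN N} (h : u =ᶠ[𝓝 x] v) : lap u x = lap v x := by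
  simp only [lap, pd2_congr h]

theorem pd2_add {u v : EN N → ℝ} {x : EN N} (hu : ContDiffAt ℝ 2 u x)
    (hv : ContDiffAt ℝ 2 v x) (i j : Fin N) :
    pd2 (fun y => u y + v y) i j x = pd2 u i j x + pd2 v i j x := by
  have h : pd (fun y => u y + v y) i =ᶠ[𝓝 x] fun y => pd u i y + pd v i y := by
    filter_upwards [hu.eventually (by norm_num), hv.eventually (by norm_num)] with y h1 h2
    exact pd_add (h1.differentiableAt (by norm_num)) (h2.differentiableAt (by norm_num)) i
  exact (pd_congr h j).trans (pd_add ((hu.pd_one i).differentiableAt (by norm_num))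
    ((hv.pd_one i).differentiableAt (by norm_num)) j)

theorem pd2_const_mul {u : EN N → ℝ} {x : EN N} (hu : ContDiffAt ℝ 2 u x) (c : ℝ)
    (i j : Fin N) : pd2 (fun y => c * u y) i j x = c * pd2 u i j x := by
  have h : pd (fun y => c * u y) i =ᶠ[𝓝 x] fun y => c * pd u i y := by
    filter_upwards [hu.eventually (by norm_num)] with y h1
    exact pd_const_mul (h1.differentiableAt (by norm_num)) c i
  exact (pd_congr h j).trans (pd_const_mul ((hu.pd_one i).differentiableAt (by norm_num)) c j)

theorem pd2_sub {u v : EN N → ℝ} {x : EN N} (hu : ContDiffAt ℝ 2 u x)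
    (hv : ContDiffAt ℝ 2 v x) (i j : Fin N) :
    pd2 (fun y => u y - v y) i j x = pd2 u i j x - pd2 v i j x := by
  have h : (fun y => u y - v y) = fun y => u y + (-1) * v y := by funext y; ring
  rw [h, pd2_add hu (contDiffAt_const.mul hv), pd2_const_mul hv]
  ring

theorem lap_add {u v : EN N → ℝ} {x : EN N} (hu : ContDiffAt ℝ 2 u x)
    (hv : ContDiffAt ℝ 2 v x) : lap (fun y => u y + v y) x = lap u x + lap v x := by
  simp only [lap, pd2_add hu hv, Finset.sum_add_distrib]

theorem lap_sub {u v : EN N → ℝ} {x : EN N} (hu : ContDiffAt ℝ 2 u x)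
    (hv : ContDiffAt ℝ 2 v x) : lap (fun y => u y - v y) x = lap u x - lap v x := by
  simp only [lap, pd2_sub hu hv, Finset.sum_sub_distrib]

theorem lap_const_mul {u : EN N → ℝ} {x : EN N} (hu : ContDiffAt ℝ 2 u x) (c : ℝ) :
    lap (fun y => c * u y) x = c * lap u x := by
  simp only [lap, pd2_const_mul hu, Finset.mul_sum]

theorem pd2_mul {u v : EN N → ℝ} {x : EN N} (hu : ContDiffAt ℝ 2 u x)
    (hv : ContDiffAt ℝ 2 v x) (i j : Fin N) :
    pd2 (fun y => u y * v y) i j x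
      = u x * pd2 v i j x + pd v i x * pd u j x + v x * pd2 u i j x + pd u i x * pd v j x := by
  have h : pd (fun y => u y * v y) i =ᶠ[𝓝 x] fun y => u y * pd v i y + v y * pd u i y := by
    filter_upwards [hu.eventually (by norm_num), hv.eventually (by norm_num)] with y h1 h2
    exact pd_mul (h1.differentiableAt (by norm_num)) (h2.differentiableAt (by norm_num)) i
  have du := hu.differentiableAt (by norm_num)
  have dv := hv.differentiableAt (by norm_num)
  have du' := (hu.pd_one i).differentiableAt (by norm_num)
  have dv' := (hv.pd_one i).differentiableAt (by norm_num)
  refine (pd_congr h j).trans ?_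
  rw [pd_add (du.fun_mul dv') (dv.fun_mul du'), pd_mul du dv', pd_mul dv du']
  change _ = u x * pd (pd v i) j x + _ + v x * pd (pd u i) j x + _
  ring

end PartialDerivatives

section IntegrationByParts

variable {N : ℕ}

theorem integrable_comp_sub_mul {A ψ : EN N → ℝ} (hA : Continuous A) (hψ : Continuous ψ)
    (hc : HasCompactSupport ψ) (x : EN N) : Integrable (fun y => A (x - y) * ψ y) :=
  ((hA.comp (continuous_const.sub continuous_id)).mul hψ).integrable_of_hasCompactSupport
    hc.mul_left

theorem ContDiff.continuous_pd {u : EN N → ℝ} (hu : ContDiff ℝ 1 u) (i : Fin N) :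
    Continuous (pd u i) :=
  (hu.continuous_fderiv (by norm_num)).clm_apply continuous_const

theorem ContDiff.pd_one {u : EN N → ℝ} (hu : ContDiff ℝ 2 u) (i : Fin N) :
    ContDiff ℝ 1 (_root_.pd u i) :=
  contDiff_iff_contDiffAt.2 fun x => (hu.contDiffAt (x := x)).pd_one i

theorem integral_pd_comp_sub_mul {A ψ : EN N → ℝ} (hA : ContDiff ℝ 1 A) (hψ : ContDiff ℝ 1 ψ)
    (hc : HasCompactSupport ψ) (x : EN N) (i : Fin N) :
    ∫ y, pd A i (x - y) * ψ y = ∫ y, A (x - y) * pd ψ i y := by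
  have hAx : ∀ y, pd (fun z => A (x - z)) i y = - pd A i (x - y) := fun y =>
    pd_const_sub A x i y (hA.differentiable (by norm_num) _)
  have h := integral_mul_fderiv_eq_neg_fderiv_mul_of_integrable (μ := volume)
    (f := fun z => A (x - z)) (g := ψ) (v := EuclideanSpace.single i (1:ℝ)) ?_ ?_ ?_ ?_ ?_
  · change ∫ y, A (x - y) * pd ψ i y = - ∫ y, pd (fun z => A (x - z)) i y * ψ y at h
    rw [h, ← integral_neg]
    simp only [hAx, neg_mul, neg_neg]
  · change Integrable fun y => pd (fun z => A (x - z)) i y * ψ y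
    simp only [hAx, neg_mul]
    exact (integrable_comp_sub_mul (hA.continuous_pd i) hψ.continuous hc x).neg
  · exact integrable_comp_sub_mul hA.continuous (hψ.continuous_pd i) (hc.pd i) x
  · exact integrable_comp_sub_mul hA.continuous hψ.continuous hc x
  · intro y _
    exact (hA.comp (contDiff_const.sub contDiff_id)).differentiable (by norm_num) y
  · intro y _
    exact hψ.differentiable (by norm_num) y

/-- A curl-free kernel `W` turns `div W` against `∂ⱼψ` into `Wⱼ` against `Δψ`. -/
theorem integral_div_mul_pd {W : Fin N → EN N → ℝ} (hW : ∀ k, ContDiff ℝ 1 (W k))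
    (hsym : ∀ j k z, pd (W k) j z = pd (W j) k z) {ψ : EN N → ℝ} (hψ : ContDiff ℝ 2 ψ)
    (hc : HasCompactSupport ψ) (x : EN N) (j : Fin N) :
    ∫ y, (∑ k, pd (W k) k (x - y)) * pd ψ j y = ∫ y, W j (x - y) * lap ψ y := by
  have hψ1 : ContDiff ℝ 1 ψ := hψ.of_le (by norm_num)
  simp only [lap, pd2, Finset.sum_mul, Finset.mul_sum]
  change _ = ∫ y, ∑ k, W j (x - y) * pd (pd ψ k) k y
  rw [integral_finsetSum _ fun k _ => integrable_comp_sub_mul ((hW k).continuous_pd k)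
      (hψ1.continuous_pd j) (hc.pd j) x,
    integral_finsetSum _ fun k _ => integrable_comp_sub_mul (hW j).continuous
      ((hψ.pd_one k).continuous_pd k) ((hc.pd k).pd k) x]
  refine Finset.sum_congr rfl fun k _ => ?_
  calc ∫ y, pd (W k) k (x - y) * pd ψ j y
      = ∫ y, W k (x - y) * pd (pd ψ j) k y :=
        integral_pd_comp_sub_mul (hW k) (hψ.pd_one j) (hc.pd j) x k
    _ = ∫ y, W k (x - y) * pd (pd ψ k) j y := by
        refine integral_congr_ae (Eventually.of_forall fun y => ?_)
        exact congrArg (W k (x - y) * ·) (pd2_comm hψ.contDiffAt j k)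
    _ = ∫ y, pd (W k) j (x - y) * pd ψ k y :=
        (integral_pd_comp_sub_mul (hW k) (hψ.pd_one k) (hc.pd k) x j).symm
    _ = ∫ y, pd (W j) k (x - y) * pd ψ k y := by simp only [hsym]
    _ = ∫ y, W j (x - y) * pd (pd ψ k) k y :=
        integral_pd_comp_sub_mul (hW j) (hψ.pd_one k) (hc.pd k) x k

end IntegrationByParts

section Kernel

variable {N : ℕ}

/-- The regularised norm `√(‖z‖² + s²)`. -/
def regNorm (s : ℝ) (z : EN N) : ℝ := √(‖z‖ ^ 2 + s ^ 2)

/-- The inverse power `√(‖z‖² + s²)⁻ᵐ` of the regularised norm. -/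
def invPow (s : ℝ) (m : ℕ) (z : EN N) : ℝ := (regNorm s z ^ m)⁻¹

/-- The regularisation `zⱼ √(‖z‖² + s²)⁻ᴺ` of the gradient of the fundamental solution. -/
def gradKer (s : ℝ) (j : Fin N) (z : EN N) : ℝ := z j * invPow s N z

theorem regNorm_pos {s : ℝ} (hs : 0 < s) (z : EN N) : 0 < regNorm s z :=
  Real.sqrt_pos.2 (by positivity)

theorem regNorm_sq (s : ℝ) (z : EN N) : regNorm s z ^ 2 = ‖z‖ ^ 2 + s ^ 2 :=
  Real.sq_sqrt (by positivity)

theorem norm_le_regNorm (s : ℝ) (z : EN N) : ‖z‖ ≤ regNorm s z :=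
  Real.le_sqrt_of_sq_le (by nlinarith [sq_nonneg s])

theorem abs_apply_le_norm (z : EN N) (i : Fin N) : |z i| ≤ ‖z‖ := by
  simpa using PiLp.norm_apply_le z i

theorem contDiff_regNorm {s : ℝ} (hs : 0 < s) {n : WithTop ℕ∞} :
    ContDiff ℝ n (regNorm s : EN N → ℝ) :=
  ((contDiff_norm_sq ℝ).add contDiff_const).sqrt fun z => by positivity

theorem contDiff_invPow {s : ℝ} (hs : 0 < s) (m : ℕ) {n : WithTop ℕ∞} :
    ContDiff ℝ n (invPow s m : EN N → ℝ) :=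
  ((contDiff_regNorm hs).pow m).inv fun z => (pow_pos (regNorm_pos hs z) m).ne'

theorem contDiff_coord (j : Fin N) {n : WithTop ℕ∞} : ContDiff ℝ n (fun z : EN N => z j) :=
  contDiff_piLp_apply 2

theorem pd_coord (i j : Fin N) (z : EN N) :
    pd (fun z : EN N => z j) i z = if i = j then 1 else 0 := by
  have h : HasFDerivAt (fun z : EN N => z j) (EuclideanSpace.proj j : EN N →L[ℝ] ℝ) z :=
    (EuclideanSpace.proj j : EN N →L[ℝ] ℝ).hasFDerivAt
  rw [pd_of_hasFDerivAt h]
  simp [eq_comm]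

theorem pd_norm_sq (i : Fin N) (z : EN N) : pd (fun z : EN N => ‖z‖ ^ 2) i z = 2 * z i := by
  rw [pd_of_hasFDerivAt (hasStrictFDerivAt_norm_sq z).hasFDerivAt]
  simp [EuclideanSpace.inner_single_right]

theorem pd_invPow {s : ℝ} (hs : 0 < s) (m : ℕ) (i : Fin N) (z : EN N) :
    pd (invPow s m) i z = -(m * z i * invPow s (m + 2) z) := by
  have hpos := regNorm_pos hs z
  have h1 : HasDerivAt (fun t : ℝ => (√t ^ m)⁻¹)
      (-(m * √(‖z‖ ^ 2 + s ^ 2) ^ (m - 1) * (1 / (2 * √(‖z‖ ^ 2 + s ^ 2))))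
        / (√(‖z‖ ^ 2 + s ^ 2) ^ m) ^ 2) (‖z‖ ^ 2 + s ^ 2) :=
    ((Real.hasDerivAt_sqrt (by positivity)).pow m).inv (pow_pos hpos m).ne'
  have h2 : pd (fun z : EN N => ‖z‖ ^ 2 + s ^ 2) i z = 2 * z i := by
    rw [pd_add ((contDiff_norm_sq ℝ).differentiable (n := 1) (by norm_num) z)
      (differentiableAt_const _), pd_norm_sq, pd_const, add_zero]
  have h3 := pd_comp (x := z) (u := fun z : EN N => ‖z‖ ^ 2 + s ^ 2) h1.differentiableAt
    (((contDiff_norm_sq ℝ).add contDiff_const).differentiable (n := 1) (by norm_num) z) i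
  rw [h1.deriv, h2] at h3
  refine h3.trans ?_
  change -(m * regNorm s z ^ (m - 1) * (1 / (2 * regNorm s z))) / (regNorm s z ^ m) ^ 2
    * (2 * z i) = -(m * z i * (regNorm s z ^ (m + 2))⁻¹)
  rcases m with _ | m
  · simp
  · rw [Nat.add_sub_cancel]
    field_simp
    ring

theorem contDiff_gradKer {s : ℝ} (hs : 0 < s) (j : Fin N) {n : WithTop ℕ∞} :
    ContDiff ℝ n (gradKer s j) :=
  (contDiff_coord j).mul (contDiff_invPow hs N)

theorem pd_gradKer {s : ℝ} (hs : 0 < s) (i j : Fin N) (z : EN N) :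
    pd (gradKer s j) i z
      = (if i = j then 1 else 0) * invPow s N z - N * (z i * (z j * invPow s (N + 2) z)) := by
  have h := pd_mul ((contDiff_coord (n := 1) j).differentiable (by norm_num) z)
    ((contDiff_invPow (N := N) hs N (n := 1)).differentiable (by norm_num) z) i
  refine h.trans ?_
  rw [pd_invPow hs, pd_coord]
  ring

theorem pd_gradKer_comm {s : ℝ} (hs : 0 < s) (i j : Fin N) (z : EN N) :
    pd (gradKer s j) i z = pd (gradKer s i) j z := by
  rw [pd_gradKer hs, pd_gradKer hs]
  simp only [eq_comm]
  ring

theorem sum_pd_gradKer {s : ℝ} (hs : 0 < s) (z : EN N) :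
    ∑ k, pd (gradKer s k) k z = N * s ^ 2 * invPow s (N + 2) z := by
  have hpos := regNorm_pos hs z
  have h1 : ∑ k, z k ^ 2 = ‖z‖ ^ 2 := (EuclideanSpace.real_norm_sq_eq z).symm
  have h2 : invPow s N z = invPow s (N + 2) z * (‖z‖ ^ 2 + s ^ 2) := by
    rw [← regNorm_sq, invPow, invPow]
    field_simp
    ring
  have h3 : ∑ k, z k * (z k * invPow s (N + 2) z) = ‖z‖ ^ 2 * invPow s (N + 2) z := by
    rw [← h1, Finset.sum_mul]
    exact Finset.sum_congr rfl fun k _ => by ring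
  simp only [pd_gradKer hs, if_true, Finset.sum_sub_distrib, ← Finset.mul_sum, h3]
  simp only [one_mul, Finset.sum_const, Finset.card_univ, Fintype.card_fin, nsmul_eq_mul, h2]
  ring

theorem pd_pd_gradKer {s : ℝ} (hs : 0 < s) (i j k : Fin N) (z : EN N) :
    pd (pd (gradKer s j) i) k z
      = -((if i = j then 1 else 0) * (N * z k * invPow s (N + 2) z))
        - N * ((if k = i then 1 else 0) * (z j * invPow s (N + 2) z)
          + z i * ((if k = j then 1 else 0) * invPow s (N + 2) z)
          - (N + 2) * (z i * (z j * (z k * invPow s (N + 4) z)))) := by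
  have e : pd (gradKer s j) i = fun z => (if i = j then 1 else 0) * invPow s N z
      - N * (z i * (z j * invPow s (N + 2) z)) := funext fun z => pd_gradKer hs i j z
  have d1 : ∀ m, DifferentiableAt ℝ (invPow s m : EN N → ℝ) z := fun m =>
    (contDiff_invPow (n := 1) hs m).differentiable (by norm_num) z
  have d2 : ∀ l, DifferentiableAt ℝ (fun z : EN N => z l) z := fun l =>
    (contDiff_coord (n := 1) l).differentiable (by norm_num) z
  have d3 := (d2 j).fun_mul (d1 (N + 2))
  have d4 := (d2 i).fun_mul d3
  rw [e, pd_sub ((d1 N).const_mul _) (d4.const_mul _), pd_const_mul (d1 N),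
    pd_const_mul d4, pd_mul (d2 i) d3, pd_mul (d2 j) (d1 _), pd_invPow hs, pd_invPow hs,
    pd_coord, pd_coord]
  push_cast
  ring

theorem invPow_nonneg (s : ℝ) (m : ℕ) (z : EN N) : 0 ≤ invPow s m z :=
  inv_nonneg.2 (pow_nonneg (Real.sqrt_nonneg _) _)

theorem abs_coord_mul_invPow_le {s : ℝ} (hs : 0 < s) (m : ℕ) (i : Fin N) (z : EN N) :
    |z i| * invPow s (m + 1) z ≤ invPow s m z := by
  have hpos := regNorm_pos hs z
  have h : |z i| ≤ regNorm s z := (abs_apply_le_norm z i).trans (norm_le_regNorm s z)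
  rw [invPow, invPow, pow_succ, mul_inv, ← mul_assoc, mul_comm |z i|, mul_assoc]
  refine mul_le_of_le_one_right (by positivity) ?_
  rw [← div_eq_mul_inv]
  exact (div_le_one hpos).2 h

theorem invPow_le {s : ℝ} (m : ℕ) {z : EN N} (hz : z ≠ 0) :
    invPow s m z ≤ (‖z‖ ^ m)⁻¹ := by
  have := norm_pos_iff.2 hz
  exact inv_anti₀ (by positivity) (pow_le_pow_left₀ this.le (norm_le_regNorm s z) m)

theorem abs_gradKer_le {s : ℝ} (hs : 0 < s) (j : Fin N) (z : EN N) :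
    |gradKer s j z| ≤ (‖z‖ ^ (N - 1))⁻¹ := by
  by_cases hz : z = 0
  · simp [gradKer, hz]
  rw [gradKer, abs_mul, abs_of_nonneg (invPow_nonneg _ _ _)]
  have h := abs_coord_mul_invPow_le hs (N - 1) j z
  rw [Nat.sub_add_cancel j.pos] at h
  exact h.trans (invPow_le _ hz)

theorem abs_pd_gradKer_le {s : ℝ} (hs : 0 < s) (i j : Fin N) {z : EN N} (hz : z ≠ 0) :
    |pd (gradKer s j) i z| ≤ (N + 1) * (‖z‖ ^ N)⁻¹ := by
  have h0 := invPow_le (s := s) N hz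
  have hn := invPow_nonneg s (N + 2) z
  have h1 : |z i * (z j * invPow s (N + 2) z)| ≤ invPow s N z := by
    rw [abs_mul, abs_mul, abs_of_nonneg hn]
    exact (mul_le_mul_of_nonneg_left (abs_coord_mul_invPow_le hs (N + 1) j z)
      (abs_nonneg _)).trans (abs_coord_mul_invPow_le hs N i z)
  have h2 : |(if i = j then (1:ℝ) else 0) * invPow s N z| ≤ invPow s N z := by
    split_ifs <;> simp [abs_of_nonneg (invPow_nonneg s N z), invPow_nonneg s N z]
  rw [pd_gradKer hs]
  calc _ ≤ invPow s N z + N * invPow s N z := by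
        refine (abs_sub _ _).trans (add_le_add h2 ?_)
        rw [abs_mul, Nat.abs_cast]
        gcongr
    _ ≤ _ := by nlinarith

theorem abs_pd_pd_gradKer_le {s : ℝ} (hs : 0 < s) (i j k : Fin N) {z : EN N} (hz : z ≠ 0) :
    |pd (pd (gradKer s j) i) k z| ≤ (3 * N + N * (N + 2)) * (‖z‖ ^ (N + 1))⁻¹ := by
  have h0 := invPow_le (s := s) (N + 1) hz
  have hb : ∀ l, |z l * invPow s (N + 2) z| ≤ invPow s (N + 1) z := fun l => by
    rw [abs_mul, abs_of_nonneg (invPow_nonneg _ _ _)]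
    exact abs_coord_mul_invPow_le hs (N + 1) l z
  have h1 : |z i * (z j * (z k * invPow s (N + 4) z))| ≤ invPow s (N + 1) z := by
    rw [abs_mul, abs_mul, abs_mul, abs_of_nonneg (invPow_nonneg _ _ _)]
    refine le_trans ?_ (abs_coord_mul_invPow_le hs (N + 1) i z)
    gcongr
    refine le_trans ?_ (abs_coord_mul_invPow_le hs (N + 2) j z)
    gcongr
    exact abs_coord_mul_invPow_le hs (N + 3) k z
  have hδ : ∀ (p : Prop) [Decidable p] (t : ℝ), |t| ≤ invPow s (N + 1) z →
      |(if p then (1:ℝ) else 0) * t| ≤ invPow s (N + 1) z := by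
    intro p _ t ht
    split_ifs
    · simpa using ht
    · simpa using invPow_nonneg s (N + 1) z
  have b1 := abs_le.1 (hδ (i = j) _ (hb k))
  have b2 := abs_le.1 (hδ (k = i) _ (hb j))
  have b3 := abs_le.1 (hδ (k = j) _ (hb i))
  have b4 := abs_le.1 h1
  have hNn : (0:ℝ) ≤ N := Nat.cast_nonneg N
  rw [pd_pd_gradKer hs]
  refine le_trans (b := (3 * N + N * (N + 2)) * invPow s (N + 1) z) ?_ (by gcongr)
  set A := (if i = j then (1:ℝ) else 0) * (z k * invPow s (N + 2) z)
  set B := (if k = i then (1:ℝ) else 0) * (z j * invPow s (N + 2) z)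
  set C := (if k = j then (1:ℝ) else 0) * (z i * invPow s (N + 2) z)
  set D := z i * (z j * (z k * invPow s (N + 4) z))
  have e : -((if i = j then (1:ℝ) else 0) * (N * z k * invPow s (N + 2) z))
        - N * (B + z i * ((if k = j then (1:ℝ) else 0) * invPow s (N + 2) z)
          - (N + 2) * D) = N * (- A - B - C + (N + 2) * D) := by
    simp only [A, C]; ring
  have e2 : (3 * N + N * (N + 2)) * invPow s (N + 1) z
      = N * (3 * invPow s (N + 1) z + (N + 2) * invPow s (N + 1) z) := by ring
  rw [e, e2, abs_mul, Nat.abs_cast]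
  gcongr
  have b5 : |(N + 2 : ℝ) * D| ≤ (N + 2) * invPow s (N + 1) z := by
    rw [abs_mul, abs_of_nonneg (by positivity)]
    gcongr
  have b6 := abs_le.1 b5
  rw [abs_le]
  constructor <;> linarith

end Kernel

section Approximation

variable {N : ℕ}

theorem invPow_eq_rpow (m : ℕ) (z : EN N) :
    invPow 1 m z = (1 + ‖z‖ ^ 2) ^ (-(m : ℝ) / 2) := by
  rw [invPow, regNorm, Real.sqrt_eq_rpow, ← Real.rpow_natCast, ← Real.rpow_mul (by positivity),
    ← Real.rpow_neg (by positivity)]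
  congr 1 <;> ring

theorem integrable_invPow : Integrable (invPow 1 (N + 2) : EN N → ℝ) := by
  have h := integrable_rpow_neg_one_add_norm_sq (E := EN N) (μ := volume) (r := ((N + 2 : ℕ) : ℝ))
    (by simp)
  exact h.congr (Eventually.of_forall fun z => (invPow_eq_rpow (N + 2) z).symm)

theorem invPow_inv_scale {c : ℝ} (hc : 0 < c) (m : ℕ) (z : EN N) :
    invPow c⁻¹ m z = c ^ m * invPow 1 m (c • z) := by
  have h : regNorm 1 (c • z) = c * regNorm c⁻¹ z := by
    rw [regNorm, regNorm, norm_smul, Real.norm_of_nonneg hc.le]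
    have : (c * ‖z‖) ^ 2 + 1 ^ 2 = c ^ 2 * (‖z‖ ^ 2 + c⁻¹ ^ 2) := by field_simp
    rw [this, Real.sqrt_mul (by positivity), Real.sqrt_sq hc.le]
  have hp := regNorm_pos (inv_pos.2 hc) z
  rw [invPow, invPow, h, mul_pow]
  field_simp

theorem exists_kernel_const (hN : N ≠ 0) : ∃ κ > (0:ℝ), ∀ Ψ : EN N → ℝ, Continuous Ψ →
    HasCompactSupport Ψ → ∀ (x : EN N) (B : ℝ),
      (∀ s > (0:ℝ), |∫ y, (∑ k, pd (gradKer s k) k (x - y)) * Ψ y| ≤ B) → |Ψ x| ≤ κ * B := by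
  have hN0 : (0:ℝ) < N := Nat.cast_pos.2 (Nat.pos_of_ne_zero hN)
  set I : ℝ := ∫ z : EN N, N * invPow 1 (N + 2) z with hI
  have hpos : ∀ z : EN N, 0 < N * invPow 1 (N + 2) z := fun z =>
    mul_pos hN0 (inv_pos.2 (pow_pos (regNorm_pos one_pos z) _))
  have hKint : Integrable (fun z : EN N => N * invPow 1 (N + 2) z) := integrable_invPow.const_mul _
  have hIpos : 0 < I := by
    rw [hI, integral_pos_iff_support_of_nonneg (fun z => (hpos z).le) hKint]
    have : Function.support (fun z : EN N => N * invPow 1 (N + 2) z) = univ :=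
      eq_univ_of_forall fun z => (hpos z).ne'
    rw [this]
    exact isOpen_univ.measure_pos _ univ_nonempty
  refine ⟨I⁻¹, inv_pos.2 hIpos, fun Ψ hΨ hc x B hB => ?_⟩
  have hlim : Tendsto (fun c : ℝ => ∫ y, (c ^ Module.finrank ℝ (EN N) *
      (I⁻¹ * (N * invPow 1 (N + 2) (c • (x - y))))) • Ψ y) atTop (𝓝 (Ψ x)) := by
    refine tendsto_integral_comp_smul_smul_of_integrable'
      (φ := fun z : EN N => I⁻¹ * (N * invPow 1 (N + 2) z))
      (fun z => mul_nonneg (inv_pos.2 hIpos).le (hpos z).le) ?_ ?_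
      (hΨ.integrable_of_hasCompactSupport hc) hΨ.continuousAt
    · rw [integral_const_mul, ← hI, inv_mul_cancel₀ hIpos.ne']
    · have h0 : Tendsto (fun z : EN N => I⁻¹ * N * (‖z‖ ^ 2)⁻¹) (Bornology.cobounded (EN N))
          (𝓝 0) := by
        have h1 : Tendsto (fun z : EN N => (‖z‖ ^ 2)⁻¹) (Bornology.cobounded (EN N)) (𝓝 0) :=
          ((tendsto_pow_atTop two_ne_zero).comp tendsto_norm_cobounded_atTop).inv_tendsto_atTop
        simpa using h1.const_mul (I⁻¹ * N)
      refine squeeze_zero' (Eventually.of_forall fun z => ?_) ?_ h0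
      · exact mul_nonneg (by positivity) (mul_nonneg (inv_pos.2 hIpos).le (hpos z).le)
      · filter_upwards [Bornology.eventually_ne_cobounded (0 : EN N)] with z hz
        have hz' := norm_pos_iff.2 hz
        rw [finrank_euclideanSpace_fin]
        calc ‖z‖ ^ N * (I⁻¹ * (N * invPow 1 (N + 2) z))
            ≤ ‖z‖ ^ N * (I⁻¹ * (N * (‖z‖ ^ (N + 2))⁻¹)) := by
              gcongr
              exact invPow_le _ hz
          _ = I⁻¹ * N * (‖z‖ ^ 2)⁻¹ := by
              rw [pow_add]
              field_simp
  refine le_of_tendsto hlim.abs ?_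
  filter_upwards [eventually_gt_atTop 0] with c hc0
  have hcB := hB c⁻¹ (inv_pos.2 hc0)
  have e : ∀ y, (c ^ Module.finrank ℝ (EN N) * (I⁻¹ * (N * invPow 1 (N + 2) (c • (x - y))))) • Ψ y
      = I⁻¹ * ((∑ k, pd (gradKer c⁻¹ k) k (x - y)) * Ψ y) := by
    intro y
    rw [sum_pd_gradKer (inv_pos.2 hc0), invPow_inv_scale hc0, finrank_euclideanSpace_fin,
      smul_eq_mul, pow_add]
    field_simp
  simp only [e]
  rw [integral_const_mul, abs_mul, abs_of_pos (inv_pos.2 hIpos)]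
  gcongr

end Approximation

section SingularIntegrals

variable {N : ℕ}

theorem integrable_indicator_inv_norm_pow (hN : N ≠ 0) (ρ : ℝ) :
    Integrable ((closedBall (0 : EN N) ρ).indicator fun z => (‖z‖ ^ (N - 1))⁻¹) := by
  have : Nonempty (Fin N) := Fin.pos_iff_nonempty.1 (Nat.pos_of_ne_zero hN)
  have h := (integrable_fun_norm_addHaar (volume : Measure (EN N))
    (f := (Iic ρ).indicator fun t : ℝ => (t ^ (N - 1))⁻¹)).2 ?_
  · refine h.congr (Eventually.of_forall fun z => ?_)
    simp [indicator]
  · rw [finrank_euclideanSpace_fin]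
    have h1 : IntegrableOn ((Iic ρ).indicator fun _ : ℝ => (1:ℝ)) (Ioi 0) := by
      rw [IntegrableOn, integrable_indicator_iff measurableSet_Iic, IntegrableOn,
        Measure.restrict_restrict measurableSet_Iic]
      exact integrableOn_const (by simp [Iic_inter_Ioi]) (by simp)
    refine h1.congr_fun (fun t ht => ?_) measurableSet_Ioi
    have ht' : t ^ (N - 1) ≠ 0 := pow_ne_zero _ (ne_of_gt ht)
    by_cases h2 : t ≤ ρ <;> simp [indicator, h2, ht']

theorem inv_pow_mul_inv_pow_le {a b r : ℝ} (ha : 0 ≤ a) (hb : 0 ≤ b) (hr : 0 < r)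
    (hab : r ≤ a + b) (m : ℕ) :
    (a ^ m)⁻¹ * (b ^ m)⁻¹ ≤ 2 ^ m * (r ^ m)⁻¹ * ((a ^ m)⁻¹ + (b ^ m)⁻¹) := by
  have key : ∀ c : ℝ, r / 2 ≤ c → (c ^ m)⁻¹ ≤ 2 ^ m * (r ^ m)⁻¹ := fun c hc => by
    rw [← div_eq_mul_inv, ← div_pow, ← inv_pow, ← one_div]
    refine pow_le_pow_left₀ (by have : 0 < c := by linarith
                                positivity) ?_ m
    rw [div_le_div_iff₀ (by linarith) hr]
    linarith
  have ha' : 0 ≤ (a ^ m)⁻¹ := by positivity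
  have hb' : 0 ≤ (b ^ m)⁻¹ := by positivity
  have hr' : 0 ≤ 2 ^ m * (r ^ m)⁻¹ := by positivity
  rcases le_total (r / 2) a with h | h
  · have := mul_le_mul_of_nonneg_right (key a h) hb'
    nlinarith [mul_nonneg hr' ha']
  · have := mul_le_mul_of_nonneg_left (key b (by linarith)) ha'
    nlinarith [mul_nonneg hr' hb']

theorem exists_singular_integral_bound (hN : N ≠ 0) : ∃ J > (0:ℝ), ∀ (P x : EN N) (K F : EN N → ℝ)
    (η m : ℝ), 0 ≤ η → 0 ≤ m → x ≠ P → ‖x - P‖ ≤ 1 → (∀ z, |K z| ≤ (‖z‖ ^ (N - 1))⁻¹) →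
      (∀ y, 1 < ‖y - P‖ → F y = 0) →
      (∀ y, ‖y - P‖ ≤ 1 → |F y| ≤ η + m * (‖y - P‖ ^ (N - 1))⁻¹) →
      |∫ y, K (x - y) * F y| ≤ J * (η + m * (‖x - P‖ ^ (N - 1))⁻¹) := by
  set k : EN N → ℝ := (closedBall (0 : EN N) 2).indicator fun z => (‖z‖ ^ (N - 1))⁻¹ with hk
  have hki : Integrable k := integrable_indicator_inv_norm_pow hN 2
  have hk0 : ∀ z, 0 ≤ k z := fun z => indicator_nonneg (fun _ _ => by positivity) z
  set J := ∫ z, k z with hJ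
  have hJ0 : 0 ≤ J := integral_nonneg hk0
  refine ⟨2 ^ N * (J + 1), by positivity, ?_⟩
  intro P x K F η m hη hm hxP hx1 hK hF0 hF
  have hr : 0 < ‖x - P‖ := norm_pos_iff.2 (sub_ne_zero.2 hxP)
  set q := 2 ^ (N - 1) * (‖x - P‖ ^ (N - 1))⁻¹ with hq
  have hq0 : 0 ≤ q := by positivity
  have hi1 : ∀ p : EN N, Integrable fun y => k (p - y) := fun p => hki.comp_sub_left p
  have hi2 : ∀ p : EN N, ∫ y, k (p - y) = J := fun p => integral_sub_left_eq_self k volume p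
  have hdom : ∀ y, ‖K (x - y) * F y‖ ≤ η * k (x - y) + m * q * (k (x - y) + k (P - y)) := by
    intro y
    rcases lt_or_ge 1 ‖y - P‖ with h | h
    · rw [hF0 y h, mul_zero, norm_zero]
      have := hk0 (x - y); have := hk0 (P - y)
      positivity
    · have e1 : k (x - y) = (‖x - y‖ ^ (N - 1))⁻¹ := by
        refine indicator_of_mem (mem_closedBall_zero_iff.2 ?_) _
        calc ‖x - y‖ = ‖(x - P) - (y - P)‖ := by congr 1; abel
          _ ≤ 2 := (norm_sub_le _ _).trans (by linarith)
      have e2 : k (P - y) = (‖y - P‖ ^ (N - 1))⁻¹ := by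
        rw [hk, indicator_of_mem (mem_closedBall_zero_iff.2 (by rw [norm_sub_rev]; linarith)),
          norm_sub_rev]
      have e3 := inv_pow_mul_inv_pow_le (norm_nonneg (x - y)) (norm_nonneg (y - P)) hr
        (norm_sub_le_norm_sub_add_norm_sub x y P) (N - 1)
      rw [e1, e2, norm_mul, Real.norm_eq_abs, Real.norm_eq_abs]
      calc |K (x - y)| * |F y| ≤ (‖x - y‖ ^ (N - 1))⁻¹ * (η + m * (‖y - P‖ ^ (N - 1))⁻¹) :=
            mul_le_mul (hK _) (hF y h) (abs_nonneg _) (by positivity)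
        _ = η * (‖x - y‖ ^ (N - 1))⁻¹
            + m * ((‖x - y‖ ^ (N - 1))⁻¹ * (‖y - P‖ ^ (N - 1))⁻¹) := by ring
        _ ≤ _ := by
          rw [mul_assoc m q]
          gcongr
  have hi3 : Integrable fun y => k (x - y) + k (P - y) := (hi1 x).add (hi1 P)
  have hi4 : Integrable fun y => η * k (x - y) + m * q * (k (x - y) + k (P - y)) :=
    ((hi1 x).const_mul η).add (hi3.const_mul (m * q))
  have hb := norm_integral_le_of_norm_le hi4 (Eventually.of_forall hdom)
  rw [Real.norm_eq_abs] at hb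
  refine hb.trans ?_
  rw [integral_add ((hi1 x).const_mul η) (hi3.const_mul (m * q)),
    integral_const_mul, integral_const_mul, integral_add (hi1 x) (hi1 P), hi2, hi2]
  have h2N : (2:ℝ) ^ N = 2 ^ (N - 1) * 2 := by rw [← pow_succ]; congr 1; omega
  have h1N : (1:ℝ) ≤ 2 ^ N := one_le_pow₀ one_le_two
  have e4 : m * q * (J + J) = 2 ^ N * J * (m * (‖x - P‖ ^ (N - 1))⁻¹) := by
    rw [hq, h2N]; ring
  have h5 : 0 ≤ m * (‖x - P‖ ^ (N - 1))⁻¹ := by positivity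
  rw [e4]
  have h6 : η * J ≤ 2 ^ N * (J + 1) * η := by
    nlinarith [mul_nonneg hη hJ0, mul_nonneg (mul_nonneg hη hJ0) (sub_nonneg.2 h1N)]
  have h7 : 2 ^ N * J * (m * (‖x - P‖ ^ (N - 1))⁻¹)
      ≤ 2 ^ N * (J + 1) * (m * (‖x - P‖ ^ (N - 1))⁻¹) := by
    gcongr; linarith
  linarith

theorem abs_integral_le_of_support_closedBall {P : EN N} {ρ c : ℝ} (hρ : 0 ≤ ρ) {φ : EN N → ℝ}
    (h0 : ∀ y, ρ < ‖y - P‖ → φ y = 0) (hc : ∀ y, ‖y - P‖ ≤ ρ → |φ y| ≤ c) :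
    |∫ y, φ y| ≤ c * (ρ ^ N * volume.real (ball (0 : EN N) 1)) := by
  have h1 : ∫ y, φ y = ∫ y in closedBall P ρ, φ y := by
    refine (setIntegral_eq_integral_of_forall_compl_eq_zero fun y hy => h0 y ?_).symm
    rw [mem_closedBall, dist_eq_norm] at hy
    exact not_le.1 hy
  have h2 : volume.real (closedBall P ρ) = ρ ^ N * volume.real (ball (0 : EN N) 1) := by
    rw [measureReal_def, Measure.addHaar_closedBall _ _ hρ, finrank_euclideanSpace_fin,
      ENNReal.toReal_mul, ENNReal.toReal_ofReal (by positivity), measureReal_def]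
  rw [h1, ← h2]
  exact norm_setIntegral_le_of_norm_le_const (f := φ) measure_closedBall_lt_top
    fun y hy => hc y (by rwa [mem_closedBall, dist_eq_norm] at hy)

end SingularIntegrals

section Cutoff

variable {N : ℕ}

/-- A smooth cutoff, equal to `1` on the unit ball and vanishing off the ball of radius `2`. -/
def unitCutoff (N : ℕ) : ContDiffBump (0 : EN N) := ⟨1, 2, one_pos, one_lt_two⟩

/-- The cutoff at scale `ρ` around `P`. -/
def cutoff (P : EN N) (ρ : ℝ) (y : EN N) : ℝ := unitCutoff N (ρ⁻¹ • (y - P))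

variable {P : EN N} {ρ : ℝ}

theorem contDiff_cutoff {n : ℕ∞} : ContDiff ℝ n (cutoff P ρ) :=
  (unitCutoff N).contDiff.comp ((contDiff_id.sub contDiff_const).const_smul _)

theorem cutoff_nonneg (y : EN N) : 0 ≤ cutoff P ρ y := (unitCutoff N).nonneg

theorem cutoff_le_one (y : EN N) : cutoff P ρ y ≤ 1 := (unitCutoff N).le_one

theorem norm_inv_smul_sub (hρ : 0 < ρ) (y : EN N) : ‖ρ⁻¹ • (y - P)‖ = ‖y - P‖ / ρ := by
  rw [norm_smul, Real.norm_of_nonneg (inv_pos.2 hρ).le, inv_mul_eq_div]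

theorem cutoff_eq_one (hρ : 0 < ρ) {y : EN N} (hy : ‖y - P‖ ≤ ρ) : cutoff P ρ y = 1 := by
  refine (unitCutoff N).one_of_mem_closedBall (mem_closedBall_zero_iff.2 ?_)
  rw [norm_inv_smul_sub hρ]
  exact (div_le_one hρ).2 hy

theorem cutoff_eq_zero (hρ : 0 < ρ) {y : EN N} (hy : 2 * ρ ≤ ‖y - P‖) : cutoff P ρ y = 0 := by
  refine (unitCutoff N).zero_of_le_dist ?_
  rw [dist_zero_right, norm_inv_smul_sub hρ]
  exact (le_div_iff₀ hρ).2 hy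

theorem cutoff_eventuallyEq_one (hρ : 0 < ρ) {y : EN N} (hy : ‖y - P‖ < ρ) :
    cutoff P ρ =ᶠ[𝓝 y] fun _ => 1 := by
  have h : ∀ᶠ z in 𝓝 y, ‖z - P‖ < ρ :=
    ((continuous_id.sub continuous_const).norm.continuousAt).eventually_lt_const hy
  filter_upwards [h] with z hz using cutoff_eq_one hρ hz.le

theorem cutoff_eventuallyEq_zero (hρ : 0 < ρ) {y : EN N} (hy : 2 * ρ < ‖y - P‖) :
    cutoff P ρ =ᶠ[𝓝 y] fun _ => 0 := by
  have h : ∀ᶠ z in 𝓝 y, 2 * ρ < ‖z - P‖ :=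
    ((continuous_id.sub continuous_const).norm.continuousAt).eventually_const_lt hy
  filter_upwards [h] with z hz using cutoff_eq_zero hρ hz.le

theorem hasCompactSupport_of_norm_sub {u : EN N → ℝ} {R : ℝ}
    (h : ∀ y, R < ‖y - P‖ → u y = 0) : HasCompactSupport u :=
  HasCompactSupport.intro (isCompact_closedBall P R) fun y hy => h y (by
    rw [mem_closedBall, dist_eq_norm] at hy
    exact not_le.1 hy)

theorem cutoff_eventuallyEq_const (hρ : 0 < ρ) {y : EN N} (hy : ¬(ρ ≤ ‖y - P‖ ∧ ‖y - P‖ ≤ 2 * ρ)) :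
    ∃ c, cutoff P ρ =ᶠ[𝓝 y] fun _ => c := by
  rcases not_and_or.1 hy with h | h
  · exact ⟨1, cutoff_eventuallyEq_one hρ (not_le.1 h)⟩
  · exact ⟨0, cutoff_eventuallyEq_zero hρ (not_le.1 h)⟩

theorem pd_cutoff_eventuallyEq_zero (hρ : 0 < ρ) {y : EN N}
    (hy : ¬(ρ ≤ ‖y - P‖ ∧ ‖y - P‖ ≤ 2 * ρ)) (k : Fin N) :
    pd (cutoff P ρ) k =ᶠ[𝓝 y] fun _ => 0 := by
  obtain ⟨c, hc⟩ := cutoff_eventuallyEq_const hρ hy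
  exact (pd_eventuallyEq hc k).trans (Eventually.of_forall fun z => pd_const c k z)

theorem pd2_cutoff_eventuallyEq_zero (hρ : 0 < ρ) {y : EN N}
    (hy : ¬(ρ ≤ ‖y - P‖ ∧ ‖y - P‖ ≤ 2 * ρ)) (k l : Fin N) :
    pd2 (cutoff P ρ) k l =ᶠ[𝓝 y] fun _ => 0 :=
  (pd_eventuallyEq (pd_cutoff_eventuallyEq_zero hρ hy k) l).trans
    (Eventually.of_forall fun z => pd_const 0 l z)

theorem lap_cutoff_eventuallyEq_zero (hρ : 0 < ρ) {y : EN N}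
    (hy : ¬(ρ ≤ ‖y - P‖ ∧ ‖y - P‖ ≤ 2 * ρ)) :
    lap (cutoff P ρ) =ᶠ[𝓝 y] fun _ => 0 := by
  have h : ∀ᶠ z in 𝓝 y, ∀ k, pd2 (cutoff P ρ) k k z = 0 :=
    eventually_all.2 fun k => pd2_cutoff_eventuallyEq_zero hρ hy k k
  filter_upwards [h] with z hz
  simp [lap, hz]

theorem continuous_lap {u : EN N → ℝ} (hu : ContDiff ℝ 2 u) : Continuous (lap u) :=
  continuous_finsetSum _ fun k _ => (hu.pd_one k).continuous_pd k

theorem pd_cutoff (k : Fin N) (y : EN N) :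
    pd (cutoff P ρ) k y = ρ⁻¹ * pd (unitCutoff N) k (ρ⁻¹ • (y - P)) :=
  pd_comp_smul_sub _ _ _ _ _
    (((unitCutoff N).contDiff (n := 1)).differentiable (by norm_num) _)

theorem pd2_cutoff (k l : Fin N) (y : EN N) :
    pd2 (cutoff P ρ) k l y = ρ⁻¹ * (ρ⁻¹ * pd2 (unitCutoff N) k l (ρ⁻¹ • (y - P))) := by
  have h : ContDiff ℝ 1 (pd (unitCutoff N) k) :=
    ((unitCutoff N).contDiff (n := 2)).pd_one k
  have hd : DifferentiableAt ℝ (fun y : EN N => pd (unitCutoff N) k (ρ⁻¹ • (y - P))) y :=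
    (h.comp ((contDiff_id.sub contDiff_const).const_smul _)).differentiable
      (by norm_num) y
  change pd (pd (cutoff P ρ) k) l y = _
  rw [funext (pd_cutoff k), pd_const_mul hd, pd_comp_smul_sub _ _ _ _ _
    (h.differentiable (by norm_num) _)]
  rfl

theorem exists_cutoff_bound (N : ℕ) : ∃ Cb > (0:ℝ), ∀ (P : EN N) (ρ : ℝ), 0 < ρ → ∀ y,
    (∀ k, |pd (cutoff P ρ) k y| ≤ Cb * ρ⁻¹) ∧ |lap (cutoff P ρ) y| ≤ Cb * (ρ⁻¹ * ρ⁻¹) := by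
  have hb : ContDiff ℝ 2 (unitCutoff N : EN N → ℝ) := (unitCutoff N).contDiff
  have hc : HasCompactSupport (unitCutoff N : EN N → ℝ) := (unitCutoff N).hasCompactSupport
  have h1 : ∀ k, ∃ C, ∀ z, |pd (unitCutoff N : EN N → ℝ) k z| ≤ C := fun k =>
    (hc.pd k).exists_bound_of_continuous (hb.pd_one k).continuous
  have h2 : ∀ k, ∃ C, ∀ z, |pd2 (unitCutoff N : EN N → ℝ) k k z| ≤ C := fun k =>
    ((hc.pd k).pd k).exists_bound_of_continuous ((hb.pd_one k).continuous_pd k)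
  choose C1 hC1 using h1
  choose C2 hC2 using h2
  have p1 : ∀ k, 0 ≤ C1 k := fun k => (abs_nonneg _).trans (hC1 k 0)
  have p2 : ∀ k, 0 ≤ C2 k := fun k => (abs_nonneg _).trans (hC2 k 0)
  have s1 : 0 ≤ ∑ k, C1 k := Finset.sum_nonneg fun k _ => p1 k
  have s2 : 0 ≤ ∑ k, C2 k := Finset.sum_nonneg fun k _ => p2 k
  refine ⟨∑ k, C1 k + ∑ k, C2 k + 1, by positivity, fun P ρ hρ y => ⟨fun k => ?_, ?_⟩⟩
  · rw [pd_cutoff, abs_mul, abs_of_pos (inv_pos.2 hρ), mul_comm]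
    gcongr
    have := Finset.single_le_sum (f := C1) (fun k _ => p1 k) (Finset.mem_univ k)
    linarith [hC1 k (ρ⁻¹ • (y - P))]
  · have e : lap (cutoff P ρ) y
        = (ρ⁻¹ * ρ⁻¹) * ∑ k, pd2 (unitCutoff N : EN N → ℝ) k k (ρ⁻¹ • (y - P)) := by
      simp only [lap, pd2_cutoff, ← Finset.mul_sum]; ring
    have hρ' := inv_pos.2 hρ
    rw [e, abs_mul, abs_of_pos (by positivity), mul_comm]
    gcongr
    have := (Finset.abs_sum_le_sum_abs (fun k =>
      pd2 (unitCutoff N : EN N → ℝ) k k (ρ⁻¹ • (y - P))) Finset.univ).trans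
      (Finset.sum_le_sum fun k _ => hC2 k _)
    linarith

end Cutoff

section Commutator

variable {N : ℕ} {P : EN N} {ρ : ℝ}

/-- The commutator `Δ(hB) - BΔh = 2∇h·∇B + hΔB`. -/
def lapCommutator (h B : EN N → ℝ) (y : EN N) : ℝ :=
  2 * ∑ k, pd h k y * pd B k y + h y * lap B y

theorem lap_mul {u v : EN N → ℝ} {x : EN N} (hu : ContDiffAt ℝ 2 u x)
    (hv : ContDiffAt ℝ 2 v x) :
    lap (fun y => u y * v y) x = v x * lap u x + lapCommutator u v x := by
  simp only [lap, lapCommutator, pd2_mul hu hv, Finset.sum_add_distrib, Finset.mul_sum]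
  simp only [two_mul, Finset.sum_add_distrib]
  have : ∀ k, pd v k x * pd u k x = pd u k x * pd v k x := fun k => mul_comm _ _
  simp only [this]
  ring

theorem contDiff_mul_pd_cutoff (hρ : 0 < ρ) {h : EN N → ℝ}
    (hh : ∀ y, ρ ≤ ‖y - P‖ → ‖y - P‖ ≤ 2 * ρ → ContDiffAt ℝ 2 h y) (k : Fin N) :
    ContDiff ℝ 1 fun y => h y * pd (cutoff P ρ) k y := by
  refine contDiff_iff_contDiffAt.2 fun y => ?_
  by_cases hy : ρ ≤ ‖y - P‖ ∧ ‖y - P‖ ≤ 2 * ρ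
  · exact ((hh y hy.1 hy.2).of_le (by norm_num)).mul
      ((contDiff_cutoff (n := 2)).pd_one k).contDiffAt
  · refine (contDiffAt_const (c := (0:ℝ))).congr_of_eventuallyEq ?_
    filter_upwards [pd_cutoff_eventuallyEq_zero hρ hy k] with z hz
    rw [hz, mul_zero]

theorem continuous_mul_lap_cutoff (hρ : 0 < ρ) {h : EN N → ℝ}
    (hh : ∀ y, ρ ≤ ‖y - P‖ → ‖y - P‖ ≤ 2 * ρ → ContDiffAt ℝ 2 h y) :
    Continuous fun y => h y * lap (cutoff P ρ) y := by
  refine continuous_iff_continuousAt.2 fun y => ?_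
  by_cases hy : ρ ≤ ‖y - P‖ ∧ ‖y - P‖ ≤ 2 * ρ
  · exact (hh y hy.1 hy.2).continuousAt.mul (continuous_lap contDiff_cutoff).continuousAt
  · refine (continuousAt_const (y := (0:ℝ))).congr ?_
    filter_upwards [lap_cutoff_eventuallyEq_zero hρ hy] with z hz
    rw [hz, mul_zero]

theorem commutator_cutoff_eq (hρ : 0 < ρ) {h : EN N → ℝ}
    (hh : ∀ y, ρ ≤ ‖y - P‖ → ‖y - P‖ ≤ 2 * ρ → ContDiffAt ℝ 2 h y) (y : EN N) :
    lapCommutator h (cutoff P ρ) y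
      = 2 * ∑ k, pd (fun y => h y * pd (cutoff P ρ) k y) k y - h y * lap (cutoff P ρ) y := by
  by_cases hy : ρ ≤ ‖y - P‖ ∧ ‖y - P‖ ≤ 2 * ρ
  · have hd := (hh y hy.1 hy.2).differentiableAt (by norm_num)
    have e : ∀ k, pd (fun y => h y * pd (cutoff P ρ) k y) k y
        = h y * pd2 (cutoff P ρ) k k y + pd h k y * pd (cutoff P ρ) k y := fun k => by
      rw [pd_mul hd (((contDiff_cutoff (n := 2)).pd_one k).differentiable (by norm_num) y),
        mul_comm (pd h k y)]
      rfl
    simp only [e, Finset.sum_add_distrib, ← Finset.mul_sum, lapCommutator, lap]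
    ring
  · have e : ∀ k, pd (fun y => h y * pd (cutoff P ρ) k y) k y = 0 := fun k => by
      refine pd_eq_zero_of_eventuallyEq_const (c := 0) ?_ k
      filter_upwards [pd_cutoff_eventuallyEq_zero hρ hy k] with z hz
      rw [hz, mul_zero]
    simp [lapCommutator, e, (lap_cutoff_eventuallyEq_zero hρ hy).eq_of_nhds,
      fun k => (pd_cutoff_eventuallyEq_zero hρ hy k).eq_of_nhds]

theorem cutoff_derivatives_eq_zero (hρ : 0 < ρ) {y : EN N} (hy : 2 * ρ < ‖y - P‖) :
    (∀ k, pd (cutoff P ρ) k y = 0) ∧ lap (cutoff P ρ) y = 0 :=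
  have h' : ¬(ρ ≤ ‖y - P‖ ∧ ‖y - P‖ ≤ 2 * ρ) := fun h => absurd h.2 (not_le.2 hy)
  ⟨fun k => (pd_cutoff_eventuallyEq_zero hρ h' k).eq_of_nhds,
    (lap_cutoff_eventuallyEq_zero hρ h').eq_of_nhds⟩

theorem integrable_comp_sub_mul_commutator (hρ : 0 < ρ) {h W : EN N → ℝ} (hW : Continuous W)
    (hh : ∀ y, ρ ≤ ‖y - P‖ → ‖y - P‖ ≤ 2 * ρ → ContDiffAt ℝ 2 h y) (x : EN N) :
    Integrable fun y => W (x - y) * lapCommutator h (cutoff P ρ) y := by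
  refine integrable_comp_sub_mul hW ?_ (hasCompactSupport_of_norm_sub (P := P) (R := 2 * ρ)
    fun y hy => ?_) x
  · rw [funext (commutator_cutoff_eq hρ hh)]
    exact (continuous_const.mul (continuous_finsetSum _ fun k _ =>
      (contDiff_mul_pd_cutoff hρ hh k).continuous_pd k)).sub (continuous_mul_lap_cutoff hρ hh)
  · obtain ⟨h1, h2⟩ := cutoff_derivatives_eq_zero hρ hy
    simp [lapCommutator, h1, h2]

/-- Contribution of a transition zone: all derivatives on `h` are moved onto the kernel. -/
theorem exists_commutator_integral_bound (hN : 2 ≤ N) : ∃ Cz > (0:ℝ), ∀ (P x : EN N)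
    (h W : EN N → ℝ) (ρ r c η : ℝ) (m : ℕ), 0 < ρ → 0 < r → ρ ≤ 2 * r → 0 ≤ c → 0 ≤ η →
      ContDiff ℝ 1 W →
      (∀ z, z ≠ 0 → |W z| ≤ c * (‖z‖ ^ m)⁻¹) →
      (∀ k z, z ≠ 0 → |pd W k z| ≤ c * (‖z‖ ^ (m + 1))⁻¹) →
      (∀ y, ρ ≤ ‖y - P‖ → ‖y - P‖ ≤ 2 * ρ → ContDiffAt ℝ 2 h y ∧ |h y| ≤ η ∧ r ≤ ‖x - y‖) →
      |∫ y, W (x - y) * lapCommutator h (cutoff P ρ) y| ≤ Cz * (c * η) * (ρ ^ (N - 2) * (r ^ m)⁻¹) := by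
  obtain ⟨Cb, hCb, hcut⟩ := exists_cutoff_bound N
  set v := volume.real (ball (0 : EN N) 1) with hv
  have hv0 : 0 ≤ v := measureReal_nonneg
  refine ⟨(4 * N + 1) * Cb * (2 ^ N * (v + 1)), by positivity, ?_⟩
  intro P x h W ρ r c η m hρ hr hρr hc hη hW hWb hWb' hh
  have hh' : ∀ y, ρ ≤ ‖y - P‖ → ‖y - P‖ ≤ 2 * ρ → ContDiffAt ℝ 2 h y := fun y a b => (hh y a b).1
  set T : Fin N → EN N → ℝ := fun k y => h y * pd (cutoff P ρ) k y with hT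
  have hTd : ∀ k, ContDiff ℝ 1 (T k) := contDiff_mul_pd_cutoff hρ hh'
  have hTc : ∀ k, HasCompactSupport (T k) := fun k =>
    hasCompactSupport_of_norm_sub (P := P) (R := 2 * ρ) fun y hy => by
      simp [hT, (cutoff_derivatives_eq_zero hρ hy).1 k]
  have hLc : HasCompactSupport fun y => h y * lap (cutoff P ρ) y :=
    hasCompactSupport_of_norm_sub (P := P) (R := 2 * ρ) fun y hy => by
      simp [(cutoff_derivatives_eq_zero hρ hy).2]
  have hi1 : ∀ k, Integrable fun y => W (x - y) * pd (T k) k y := fun k =>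
    integrable_comp_sub_mul hW.continuous ((hTd k).continuous_pd k) ((hTc k).pd k) x
  have hi2 : Integrable fun y => W (x - y) * (h y * lap (cutoff P ρ) y) :=
    integrable_comp_sub_mul hW.continuous (continuous_mul_lap_cutoff hρ hh') hLc x
  have e : ∫ y, W (x - y) * lapCommutator h (cutoff P ρ) y
      = 2 * ∑ k, (∫ y, pd W k (x - y) * T k y) - ∫ y, W (x - y) * (h y * lap (cutoff P ρ) y) := by
    have e1 : ∀ y, W (x - y) * lapCommutator h (cutoff P ρ) y
        = 2 * ∑ k, W (x - y) * pd (T k) k y - W (x - y) * (h y * lap (cutoff P ρ) y) := by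
      intro y
      rw [commutator_cutoff_eq hρ hh', ← Finset.mul_sum]
      ring
    simp only [e1]
    rw [integral_sub ((integrable_finsetSum _ fun k _ => hi1 k).const_mul 2) hi2,
      integral_const_mul, integral_finsetSum _ fun k _ => hi1 k]
    congr 2
    exact Finset.sum_congr rfl fun k _ => (integral_pd_comp_sub_mul hW (hTd k) (hTc k) x k).symm
  have hzone : ∀ y, ρ ≤ ‖y - P‖ → ‖y - P‖ ≤ 2 * ρ → x - y ≠ 0 ∧
      ∀ l, (‖x - y‖ ^ l)⁻¹ ≤ (r ^ l)⁻¹ := fun y a b => by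
    have h3 := (hh y a b).2.2
    refine ⟨norm_pos_iff.1 (hr.trans_le h3), fun l => ?_⟩
    exact inv_anti₀ (by positivity) (pow_le_pow_left₀ hr.le h3 l)
  have hρ2 : 0 ≤ 2 * ρ := by positivity
  have hρ' := inv_pos.2 hρ
  have b1 : ∀ k, |∫ y, pd W k (x - y) * T k y|
      ≤ c * (r ^ (m + 1))⁻¹ * (η * (Cb * ρ⁻¹)) * ((2 * ρ) ^ N * v) := by
    intro k
    refine abs_integral_le_of_support_closedBall (P := P) hρ2 (fun y hy => ?_) fun y hy => ?_
    · simp [hT, (cutoff_derivatives_eq_zero hρ hy).1 k]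
    · by_cases hy' : ρ ≤ ‖y - P‖
      · rw [abs_mul, hT, abs_mul]
        have h1 := (hWb' k _ (hzone y hy' hy).1).trans
          (mul_le_mul_of_nonneg_left ((hzone y hy' hy).2 (m + 1)) hc)
        exact mul_le_mul h1 (mul_le_mul (hh y hy' hy).2.1 ((hcut P ρ hρ y).1 k) (abs_nonneg _) hη)
          (by positivity) (by positivity)
      · have : pd (cutoff P ρ) k y = 0 :=
          (pd_cutoff_eventuallyEq_zero hρ (fun h => hy' h.1) k).eq_of_nhds
        simp only [hT, this, mul_zero, abs_zero]
        positivity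
  have b2 : |∫ y, W (x - y) * (h y * lap (cutoff P ρ) y)|
      ≤ c * (r ^ m)⁻¹ * (η * (Cb * (ρ⁻¹ * ρ⁻¹))) * ((2 * ρ) ^ N * v) := by
    refine abs_integral_le_of_support_closedBall (P := P) hρ2 (fun y hy => ?_) fun y hy => ?_
    · simp [(cutoff_derivatives_eq_zero hρ hy).2]
    · by_cases hy' : ρ ≤ ‖y - P‖
      · rw [abs_mul, abs_mul]
        have h1 := (hWb _ (hzone y hy' hy).1).trans
          (mul_le_mul_of_nonneg_left ((hzone y hy' hy).2 m) hc)
        exact mul_le_mul h1 (mul_le_mul (hh y hy' hy).2.1 (hcut P ρ hρ y).2 (abs_nonneg _) hη)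
          (by positivity) (by positivity)
      · have : lap (cutoff P ρ) y = 0 :=
          (lap_cutoff_eventuallyEq_zero hρ (fun h => hy' h.1)).eq_of_nhds
        simp only [this, mul_zero, abs_zero]
        positivity
  have hN2 : ρ ^ N = ρ ^ (N - 2) * (ρ * ρ) := by
    rw [← pow_two, ← pow_add]; congr 1; omega
  have b3 : c * (r ^ (m + 1))⁻¹ * (η * (Cb * ρ⁻¹)) * ((2 * ρ) ^ N * v)
      ≤ 2 * (Cb * (2 ^ N * v) * (c * η) * (ρ ^ (N - 2) * (r ^ m)⁻¹)) := by
    have e3 : c * (r ^ (m + 1))⁻¹ * (η * (Cb * ρ⁻¹)) * ((2 * ρ) ^ N * v)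
        = Cb * (2 ^ N * v) * (c * η) * (ρ ^ (N - 2) * (r ^ m)⁻¹) * (ρ / r) := by
      rw [mul_pow, hN2, pow_succ]
      field_simp
    rw [e3, mul_comm (2:ℝ)]
    exact mul_le_mul_of_nonneg_left ((div_le_iff₀ hr).2 hρr) (by positivity)
  have b4 : c * (r ^ m)⁻¹ * (η * (Cb * (ρ⁻¹ * ρ⁻¹))) * ((2 * ρ) ^ N * v)
      = Cb * (2 ^ N * v) * (c * η) * (ρ ^ (N - 2) * (r ^ m)⁻¹) := by
    rw [mul_pow, hN2]
    field_simp
  set X := Cb * (2 ^ N * v) * (c * η) * (ρ ^ (N - 2) * (r ^ m)⁻¹) with hX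
  have b5 : |∑ k, ∫ y, pd W k (x - y) * T k y| ≤ N * (2 * X) := by
    refine (Finset.abs_sum_le_sum_abs _ _).trans ?_
    refine (Finset.sum_le_sum fun k _ => (b1 k).trans b3).trans ?_
    simp
  rw [e]
  refine (abs_sub _ _).trans ?_
  rw [abs_mul, abs_two]
  have hXle : (4 * N + 1) * X ≤ (4 * N + 1) * Cb * (2 ^ N * (v + 1)) * (c * η)
      * (ρ ^ (N - 2) * (r ^ m)⁻¹) := by
    have : (4 * N + 1) * X = (4 * N + 1) * Cb * (2 ^ N * v) * (c * η)
      * (ρ ^ (N - 2) * (r ^ m)⁻¹) := by rw [hX]; ring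
    rw [this]
    gcongr
    linarith
  rw [b4] at b2
  linarith

end Commutator

section LocalEstimates

variable {N : ℕ}

theorem lap_const (c : ℝ) (x : EN N) : lap (fun _ => c) x = 0 := by
  have h : ∀ k : Fin N, pd (fun _ : EN N => c) k = fun _ => 0 := fun k =>
    funext fun z => pd_const c k z
  refine Finset.sum_eq_zero fun k _ => ?_
  change pd (pd (fun _ : EN N => c) k) k x = 0
  rw [h, pd_const]

/-- The cutoff of the annulus `ρ ≤ |y - P| ≤ 2σ`. -/
def annCutoff (P : EN N) (ρ σ : ℝ) (y : EN N) : ℝ := cutoff P σ y - cutoff P ρ y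

/-- Quantitative hypotheses on a solution of `Δh = G` in the annulus `ρ ≤ |y - P| ≤ 2σ`. -/
structure AnnulusBounds (P : EN N) (h G : EN N → ℝ) (ρ σ η₁ η₂ η₃ μ : ℝ) : Prop where
  pos : 0 < ρ
  le : 8 * ρ ≤ σ
  le_one : 2 * σ ≤ 1
  nonneg₁ : 0 ≤ η₁
  nonneg₂ : 0 ≤ η₂
  nonneg₃ : 0 ≤ η₃
  nonneg₄ : 0 ≤ μ
  contDiffAt : ∀ y, ρ ≤ ‖y - P‖ → ‖y - P‖ ≤ 2 * σ → ContDiffAt ℝ 2 h y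
  contDiffAt_lap : ∀ y, ρ ≤ ‖y - P‖ → ‖y - P‖ ≤ 2 * σ → ContDiffAt ℝ 1 G y
  lap_eq : ∀ y, ρ ≤ ‖y - P‖ → ‖y - P‖ ≤ 2 * σ → lap h y = G y
  abs_lap_le : ∀ y, ρ ≤ ‖y - P‖ → ‖y - P‖ ≤ 2 * σ →
    |G y| ≤ η₃ + μ * (‖y - P‖ ^ (N - 1))⁻¹
  abs_le_inner : ∀ y, ρ ≤ ‖y - P‖ → ‖y - P‖ ≤ 2 * ρ → |h y| ≤ η₁
  abs_le_outer : ∀ y, σ ≤ ‖y - P‖ → ‖y - P‖ ≤ 2 * σ → |h y| ≤ η₂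

theorem abs_annCutoff_le_one (P : EN N) (ρ σ : ℝ) (y : EN N) : |annCutoff P ρ σ y| ≤ 1 := by
  have h1 := cutoff_nonneg (P := P) (ρ := σ) y
  have h2 := cutoff_le_one (P := P) (ρ := σ) y
  have h3 := cutoff_nonneg (P := P) (ρ := ρ) y
  have h4 := cutoff_le_one (P := P) (ρ := ρ) y
  rw [annCutoff, abs_le]
  constructor <;> linarith

theorem contDiff_annCutoff {P : EN N} {ρ σ : ℝ} {n : ℕ∞} : ContDiff ℝ n (annCutoff P ρ σ) :=
  contDiff_cutoff.sub contDiff_cutoff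

theorem continuous_mul_pd_cutoff {P : EN N} {ρ : ℝ} (hρ : 0 < ρ) {G : EN N → ℝ}
    (hG : ∀ y, ρ ≤ ‖y - P‖ → ‖y - P‖ ≤ 2 * ρ → ContinuousAt G y) (k : Fin N) :
    Continuous fun y => G y * pd (cutoff P ρ) k y := by
  refine continuous_iff_continuousAt.2 fun y => ?_
  by_cases hy : ρ ≤ ‖y - P‖ ∧ ‖y - P‖ ≤ 2 * ρ
  · exact (hG y hy.1 hy.2).mul ((contDiff_cutoff (n := 1)).continuous_pd k).continuousAt
  · refine (continuousAt_const (y := (0:ℝ))).congr ?_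
    filter_upwards [pd_cutoff_eventuallyEq_zero hρ hy k] with z hz
    rw [hz, mul_zero]

namespace AnnulusBounds

variable {P : EN N} {h G : EN N → ℝ} {ρ σ η₁ η₂ η₃ μ : ℝ}

theorem pos_outer (H : AnnulusBounds P h G ρ σ η₁ η₂ η₃ μ) : 0 < σ := by
  linarith [H.pos, H.le]

theorem annCutoff_eventuallyEq_zero (H : AnnulusBounds P h G ρ σ η₁ η₂ η₃ μ) {y : EN N}
    (hy : ¬(ρ ≤ ‖y - P‖ ∧ ‖y - P‖ ≤ 2 * σ)) : annCutoff P ρ σ =ᶠ[𝓝 y] fun _ => 0 := by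
  have h1 := H.pos
  have h2 := H.le
  rcases not_and_or.1 hy with h | h
  · filter_upwards [cutoff_eventuallyEq_one h1 (not_le.1 h),
      cutoff_eventuallyEq_one (ρ := σ) H.pos_outer (y := y) (by linarith [not_le.1 h])]
      with z hz hz'
    rw [annCutoff, hz, hz', sub_self]
  · filter_upwards [cutoff_eventuallyEq_zero H.pos_outer (not_le.1 h),
      cutoff_eventuallyEq_zero (ρ := ρ) h1 (y := y) (by linarith [not_le.1 h])]
      with z hz hz'
    rw [annCutoff, hz, hz', sub_self]

theorem annCutoff_eventuallyEq_one (H : AnnulusBounds P h G ρ σ η₁ η₂ η₃ μ) {y : EN N}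
    (h1 : 2 * ρ < ‖y - P‖) (h2 : ‖y - P‖ < σ) : annCutoff P ρ σ =ᶠ[𝓝 y] fun _ => 1 := by
  filter_upwards [cutoff_eventuallyEq_one H.pos_outer h2, cutoff_eventuallyEq_zero H.pos h1]
    with z hz hz'
  rw [annCutoff, hz, hz', sub_zero]

theorem contDiff_mul (H : AnnulusBounds P h G ρ σ η₁ η₂ η₃ μ) :
    ContDiff ℝ 2 fun y => h y * annCutoff P ρ σ y := by
  refine contDiff_iff_contDiffAt.2 fun y => ?_
  by_cases hy : ρ ≤ ‖y - P‖ ∧ ‖y - P‖ ≤ 2 * σ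
  · exact (H.contDiffAt y hy.1 hy.2).mul (contDiff_annCutoff (n := 2)).contDiffAt
  · refine (contDiffAt_const (c := (0:ℝ))).congr_of_eventuallyEq ?_
    filter_upwards [H.annCutoff_eventuallyEq_zero hy] with z hz
    rw [hz, mul_zero]

theorem contDiff_mul_lap (H : AnnulusBounds P h G ρ σ η₁ η₂ η₃ μ) :
    ContDiff ℝ 1 fun y => annCutoff P ρ σ y * G y := by
  refine contDiff_iff_contDiffAt.2 fun y => ?_
  by_cases hy : ρ ≤ ‖y - P‖ ∧ ‖y - P‖ ≤ 2 * σ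
  · exact (contDiff_annCutoff (n := 1)).contDiffAt.mul (H.contDiffAt_lap y hy.1 hy.2)
  · refine (contDiffAt_const (c := (0:ℝ))).congr_of_eventuallyEq ?_
    filter_upwards [H.annCutoff_eventuallyEq_zero hy] with z hz
    rw [hz, zero_mul]

theorem annCutoff_eq_zero (H : AnnulusBounds P h G ρ σ η₁ η₂ η₃ μ) {y : EN N}
    (hy : 2 * σ < ‖y - P‖) : annCutoff P ρ σ y = 0 :=
  (H.annCutoff_eventuallyEq_zero fun h => absurd h.2 (not_le.2 hy)).eq_of_nhds

theorem hasCompactSupport_mul (H : AnnulusBounds P h G ρ σ η₁ η₂ η₃ μ) :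
    HasCompactSupport fun y => h y * annCutoff P ρ σ y :=
  hasCompactSupport_of_norm_sub (P := P) (R := 2 * σ) fun y hy => by
    rw [H.annCutoff_eq_zero hy, mul_zero]

theorem hasCompactSupport_mul_lap (H : AnnulusBounds P h G ρ σ η₁ η₂ η₃ μ) :
    HasCompactSupport fun y => annCutoff P ρ σ y * G y :=
  hasCompactSupport_of_norm_sub (P := P) (R := 2 * σ) fun y hy => by
    rw [H.annCutoff_eq_zero hy, zero_mul]

theorem mul_eventuallyEq (H : AnnulusBounds P h G ρ σ η₁ η₂ η₃ μ) {x : EN N}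
    (h1 : 4 * ρ ≤ ‖x - P‖) (h2 : 2 * ‖x - P‖ ≤ σ) :
    (fun y => h y * annCutoff P ρ σ y) =ᶠ[𝓝 x] h := by
  have := H.pos
  filter_upwards [H.annCutoff_eventuallyEq_one (y := x) (by linarith) (by linarith)] with z hz
  rw [hz, mul_one]

theorem contDiffAt_outer (H : AnnulusBounds P h G ρ σ η₁ η₂ η₃ μ) (y : EN N)
    (h1 : σ ≤ ‖y - P‖) (h2 : ‖y - P‖ ≤ 2 * σ) : ContDiffAt ℝ 2 h y :=
  H.contDiffAt y (by linarith [H.pos, H.le]) h2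

theorem contDiffAt_inner (H : AnnulusBounds P h G ρ σ η₁ η₂ η₃ μ) (y : EN N)
    (h1 : ρ ≤ ‖y - P‖) (h2 : ‖y - P‖ ≤ 2 * ρ) : ContDiffAt ℝ 2 h y :=
  H.contDiffAt y h1 (by linarith [H.pos, H.le])

theorem lap_mul_annCutoff (H : AnnulusBounds P h G ρ σ η₁ η₂ η₃ μ) (y : EN N) :
    lap (fun y => h y * annCutoff P ρ σ y) y = annCutoff P ρ σ y * G y
      + lapCommutator h (cutoff P σ) y - lapCommutator h (cutoff P ρ) y := by
  have hs : ∀ k, pd (annCutoff P ρ σ) k y = pd (cutoff P σ) k y - pd (cutoff P ρ) k y := fun k =>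
    pd_sub ((contDiff_cutoff (n := 1)).differentiable (by norm_num) y)
      ((contDiff_cutoff (n := 1)).differentiable (by norm_num) y) k
  have hl : lap (annCutoff P ρ σ) y = lap (cutoff P σ) y - lap (cutoff P ρ) y :=
    lap_sub (contDiff_cutoff (n := 2)).contDiffAt (contDiff_cutoff (n := 2)).contDiffAt
  have hc : lapCommutator h (cutoff P σ) y - lapCommutator h (cutoff P ρ) y
      = lapCommutator h (annCutoff P ρ σ) y := by
    simp only [lapCommutator, hs, hl, mul_sub, Finset.sum_sub_distrib]
    ring
  rw [add_sub_assoc, hc]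
  by_cases hy : ρ ≤ ‖y - P‖ ∧ ‖y - P‖ ≤ 2 * σ
  · rw [lap_mul (H.contDiffAt y hy.1 hy.2) (contDiff_annCutoff (n := 2)).contDiffAt,
      H.lap_eq y hy.1 hy.2]
  · have h0 := H.annCutoff_eventuallyEq_zero hy
    have e1 : lap (fun y => h y * annCutoff P ρ σ y) y = lap (fun _ => (0:ℝ)) y := by
      refine lap_congr ?_
      filter_upwards [h0] with z hz
      rw [hz, mul_zero]
    have e2 : lap (annCutoff P ρ σ) y = lap (fun _ => (0:ℝ)) y := lap_congr h0
    have e4 : ∀ k, pd (annCutoff P ρ σ) k y = 0 := fun k =>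
      pd_eq_zero_of_eventuallyEq_const h0 k
    simp [lapCommutator, e1, e2, lap_const, e4, h0.eq_of_nhds]

end AnnulusBounds

/-- Representation up to the contribution of the two transition zones. -/
theorem exists_transition_bound (hN : 2 ≤ N) : ∃ Cz > (0:ℝ), ∀ (P x : EN N) (h G W : EN N → ℝ)
    (ρ σ η₁ η₂ η₃ μ c : ℝ) (m : ℕ), AnnulusBounds P h G ρ σ η₁ η₂ η₃ μ →
      4 * ρ ≤ ‖x - P‖ → 2 * ‖x - P‖ ≤ σ → 0 ≤ c → ContDiff ℝ 1 W →
      (∀ z, z ≠ 0 → |W z| ≤ c * (‖z‖ ^ m)⁻¹) →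
      (∀ k z, z ≠ 0 → |pd W k z| ≤ c * (‖z‖ ^ (m + 1))⁻¹) →
      |∫ y, W (x - y) * lap (fun y => h y * annCutoff P ρ σ y) y|
        ≤ |∫ y, W (x - y) * (annCutoff P ρ σ y * G y)|
          + Cz * (c * η₁) * (ρ ^ (N - 2) * ((‖x - P‖ / 2) ^ m)⁻¹)
          + Cz * (c * η₂) * (σ ^ (N - 2) * ((σ / 2) ^ m)⁻¹) := by
  obtain ⟨Cz, hCz, hz⟩ := exists_commutator_integral_bound hN
  refine ⟨Cz, hCz, ?_⟩
  intro P x h G W ρ σ η₁ η₂ η₃ μ c m H h1 h2 hc hW hWb hWb'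
  have hρ := H.pos
  have hσ := H.pos_outer
  have i1 : Integrable fun y => W (x - y) * (annCutoff P ρ σ y * G y) :=
    integrable_comp_sub_mul hW.continuous H.contDiff_mul_lap.continuous
      H.hasCompactSupport_mul_lap x
  have i2 := integrable_comp_sub_mul_commutator hσ hW.continuous H.contDiffAt_outer x
  have i3 := integrable_comp_sub_mul_commutator hρ hW.continuous H.contDiffAt_inner x
  have b2 := hz P x h W σ (σ / 2) c η₂ m hσ (by positivity) (by linarith) hc H.nonneg₂ hW hWb hWb'
    fun y ha hb => ⟨H.contDiffAt_outer y ha hb, H.abs_le_outer y ha hb, by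
      have := norm_sub_norm_le (y - P) (x - P)
      rw [sub_sub_sub_cancel_right, norm_sub_rev y x] at this
      linarith⟩
  have b3 := hz P x h W ρ (‖x - P‖ / 2) c η₁ m hρ (by linarith) (by linarith) hc H.nonneg₁ hW hWb
    hWb' fun y ha hb => ⟨H.contDiffAt_inner y ha hb, H.abs_le_inner y ha hb, by
      have := norm_sub_norm_le (x - P) (y - P)
      rw [sub_sub_sub_cancel_right] at this
      linarith⟩
  have e : ∫ y, W (x - y) * lap (fun y => h y * annCutoff P ρ σ y) y
      = (∫ y, W (x - y) * (annCutoff P ρ σ y * G y))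
        + (∫ y, W (x - y) * lapCommutator h (cutoff P σ) y)
        - ∫ y, W (x - y) * lapCommutator h (cutoff P ρ) y := by
    have i12 : Integrable fun y => W (x - y) * (annCutoff P ρ σ y * G y)
        + W (x - y) * lapCommutator h (cutoff P σ) y := i1.add i2
    rw [← integral_add i1 i2, ← integral_sub i12 i3]
    refine integral_congr_ae (Eventually.of_forall fun y => ?_)
    simp only [H.lap_mul_annCutoff]
    ring
  rw [e]
  refine (abs_sub _ _).trans ?_
  have := abs_add_le (∫ y, W (x - y) * (annCutoff P ρ σ y * G y))
    (∫ y, W (x - y) * lapCommutator h (cutoff P σ) y)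
  linarith

theorem inv_half_pow (r : ℝ) (m : ℕ) : ((r / 2) ^ m)⁻¹ = 2 ^ m * (r ^ m)⁻¹ := by
  rw [div_pow, inv_div, div_eq_mul_inv]

/-- Interior gradient estimate in an annulus. -/
theorem exists_gradient_bound (hN : 2 ≤ N) {σ : ℝ} (hσ : 0 < σ) : ∃ C > (0:ℝ),
    ∀ (P x : EN N) (h G : EN N → ℝ) (ρ η₁ η₂ η₃ μ : ℝ), AnnulusBounds P h G ρ σ η₁ η₂ η₃ μ →
      4 * ρ ≤ ‖x - P‖ → 2 * ‖x - P‖ ≤ σ → ∀ j,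
      |pd h j x| ≤ C * (η₂ + η₃ + (η₁ * ρ ^ (N - 2) + μ) * (‖x - P‖ ^ (N - 1))⁻¹) := by
  obtain ⟨Cz, hCz, hz⟩ := exists_transition_bound hN
  obtain ⟨κ, hκ, hk⟩ := exists_kernel_const (N := N) (by omega)
  obtain ⟨J, hJ, hj⟩ := exists_singular_integral_bound (N := N) (by omega)
  set c : ℝ := N + 1 with hc
  set S : ℝ := σ ^ (N - 2) * ((σ / 2) ^ (N - 1))⁻¹ with hS
  have hc0 : 0 < c := by positivity
  have hS0 : 0 < S := by positivity
  refine ⟨κ * (J + Cz * c * 2 ^ (N - 1) + Cz * c * S), by positivity, ?_⟩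
  intro P x h G ρ η₁ η₂ η₃ μ H h1 h2 j
  have hρ := H.pos
  have hr : 0 < ‖x - P‖ := by linarith
  have n1 := H.nonneg₁
  have n2 := H.nonneg₂
  have n3 := H.nonneg₃
  have n4 := H.nonneg₄
  have hψ := H.contDiff_mul
  have key := hk (pd (fun y => h y * annCutoff P ρ σ y) j) (hψ.pd_one j).continuous
    (H.hasCompactSupport_mul.pd j) x
    (J * (η₃ + μ * (‖x - P‖ ^ (N - 1))⁻¹)
      + Cz * (c * η₁) * (ρ ^ (N - 2) * ((‖x - P‖ / 2) ^ (N - 1))⁻¹)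
      + Cz * (c * η₂) * S) fun s hs => by
    rw [integral_div_mul_pd (fun k => contDiff_gradKer hs k)
      (fun j k z => pd_gradKer_comm hs j k z) hψ H.hasCompactSupport_mul x j]
    have hNc : (1:ℝ) ≤ c := by rw [hc]; linarith [(Nat.cast_nonneg N : (0:ℝ) ≤ N)]
    have hb := hz P x h G (gradKer s j) ρ σ η₁ η₂ η₃ μ c (N - 1) H h1 h2 hc0.le
      (contDiff_gradKer hs j)
      (fun z _ => (abs_gradKer_le hs j z).trans (le_mul_of_one_le_left (by positivity) hNc))
      (fun k z hz => by
        rw [show N - 1 + 1 = N by omega]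
        exact abs_pd_gradKer_le hs k j hz)
    have hs' := hj P x (gradKer s j) (fun y => annCutoff P ρ σ y * G y) η₃ μ n3 n4
      (fun e => by simp [e] at hr) (by linarith [H.le_one]) (abs_gradKer_le hs j)
      (fun y hy => by
        rw [H.annCutoff_eq_zero (by linarith [H.le_one]), zero_mul])
      (fun y _ => by
        by_cases hy : ρ ≤ ‖y - P‖ ∧ ‖y - P‖ ≤ 2 * σ
        · rw [abs_mul]
          exact (mul_le_of_le_one_left (abs_nonneg _) (abs_annCutoff_le_one P ρ σ y)).trans
            (H.abs_lap_le y hy.1 hy.2)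
        · rw [(H.annCutoff_eventuallyEq_zero hy).eq_of_nhds, zero_mul, abs_zero]
          positivity)
    linarith
  rw [pd_congr (H.mul_eventuallyEq h1 h2)] at key
  refine key.trans ?_
  rw [inv_half_pow, mul_assoc κ]
  refine mul_le_mul_of_nonneg_left ?_ hκ.le
  set q := (‖x - P‖ ^ (N - 1))⁻¹ with hq
  have hq0 : 0 < q := by positivity
  have a1 : 0 ≤ J * (η₂ + η₁ * ρ ^ (N - 2) * q) := by positivity
  have a2 : 0 ≤ Cz * c * 2 ^ (N - 1) * (η₂ + η₃ + μ * q) := by positivity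
  have a3 : 0 ≤ Cz * c * S * (η₃ + (η₁ * ρ ^ (N - 2) + μ) * q) := by positivity
  linarith

/-- Interior second derivative estimate in an annulus. -/
theorem exists_hessian_bound (hN : 2 ≤ N) {σ : ℝ} (hσ : 0 < σ) : ∃ C > (0:ℝ),
    ∀ (P x : EN N) (h G : EN N → ℝ) (ρ η₁ η₂ η₃ μ M : ℝ), AnnulusBounds P h G ρ σ η₁ η₂ η₃ μ →
      0 ≤ M → (∀ y, ρ ≤ ‖y - P‖ → ‖y - P‖ ≤ 2 * ρ → |G y| ≤ M) →
      (∀ k y, ρ ≤ ‖y - P‖ → ‖y - P‖ ≤ 2 * σ →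
        |pd G k y| ≤ η₃ + μ * (‖y - P‖ ^ (N - 1))⁻¹) →
      4 * ρ ≤ ‖x - P‖ → 2 * ‖x - P‖ ≤ σ → ∀ i j,
      |pd2 h j i x| ≤ C * (η₂ + η₃ + (M * ρ ^ (N - 1) + μ) * (‖x - P‖ ^ (N - 1))⁻¹
        + η₁ * ρ ^ (N - 2) * (‖x - P‖ ^ N)⁻¹) := by
  obtain ⟨Cz, hCz, hz⟩ := exists_transition_bound hN
  obtain ⟨κ, hκ, hk⟩ := exists_kernel_const (N := N) (by omega)
  obtain ⟨J, hJ, hj⟩ := exists_singular_integral_bound (N := N) (by omega)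
  obtain ⟨Cb, hCb, hcut⟩ := exists_cutoff_bound N
  set v := volume.real (ball (0 : EN N) 1) with hv
  have hv0 : 0 ≤ v := measureReal_nonneg
  set c : ℝ := 3 * N + N * (N + 2) with hc
  set S : ℝ := σ ^ (N - 2) * ((σ / 2) ^ N)⁻¹ with hS
  set A : ℝ := 1 + Cb * σ⁻¹ with hA
  have hN' : (2:ℝ) ≤ N := by exact_mod_cast hN
  have hc0 : 0 < c := by positivity
  have hS0 : 0 < S := by positivity
  have hA0 : 0 < A := by positivity
  set D : ℝ := 2 ^ (N - 1) * Cb * 2 ^ N * v with hD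
  have hD0 : 0 ≤ D := by positivity
  refine ⟨κ * (J * A + D + Cz * c * 2 ^ N + Cz * c * S), by positivity, ?_⟩
  intro P x h G ρ η₁ η₂ η₃ μ M H hM hGM hGd h1 h2 i j
  have hρ := H.pos
  have hr : 0 < ‖x - P‖ := by linarith
  have n1 := H.nonneg₁
  have n2 := H.nonneg₂
  have n3 := H.nonneg₃
  have n4 := H.nonneg₄
  have hψ := H.contDiff_mul
  have hψc := H.hasCompactSupport_mul
  set q := (‖x - P‖ ^ (N - 1))⁻¹ with hq
  have hq0 : 0 < q := by positivity
  have hGa : ∀ y, ρ ≤ ‖y - P‖ → ‖y - P‖ ≤ 2 * ρ → ContinuousAt G y := fun y ha hb =>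
    (H.contDiffAt_lap y ha (by linarith [H.le])).continuousAt
  have hF2 := continuous_mul_pd_cutoff hρ hGa i
  have hF2c : HasCompactSupport fun y => G y * pd (cutoff P ρ) i y :=
    hasCompactSupport_of_norm_sub (P := P) (R := 2 * ρ) fun y hy => by
      simp [(cutoff_derivatives_eq_zero hρ hy).1 i]
  set F1 : EN N → ℝ := fun y => pd (fun y => annCutoff P ρ σ y * G y) i y
    + G y * pd (cutoff P ρ) i y with hF1
  have hF1b : ∀ y, |F1 y| ≤ A * η₃ + A * μ * (‖y - P‖ ^ (N - 1))⁻¹ := by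
    intro y
    by_cases hy : ρ ≤ ‖y - P‖ ∧ ‖y - P‖ ≤ 2 * σ
    · have hs : pd (annCutoff P ρ σ) i y = pd (cutoff P σ) i y - pd (cutoff P ρ) i y :=
        pd_sub ((contDiff_cutoff (n := 1)).differentiable (by norm_num) y)
          ((contDiff_cutoff (n := 1)).differentiable (by norm_num) y) i
      have e : F1 y = annCutoff P ρ σ y * pd G i y + G y * pd (cutoff P σ) i y := by
        simp only [hF1]
        rw [pd_mul ((contDiff_annCutoff (n := 1)).differentiable (by norm_num) y)
          ((H.contDiffAt_lap y hy.1 hy.2).differentiableAt (by norm_num)), hs]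
        ring
      rw [e]
      refine (abs_add_le _ _).trans ?_
      rw [abs_mul, abs_mul]
      have t1 := (mul_le_of_le_one_left (abs_nonneg _) (abs_annCutoff_le_one P ρ σ y)).trans
        (hGd i y hy.1 hy.2)
      have t2 := mul_le_mul (H.abs_lap_le y hy.1 hy.2) ((hcut P σ hσ y).1 i) (abs_nonneg _)
        (by positivity)
      rw [hA]
      linarith
    · have h0 : pd (fun y => annCutoff P ρ σ y * G y) i y = 0 := by
        refine pd_eq_zero_of_eventuallyEq_const (c := 0) ?_ i
        filter_upwards [H.annCutoff_eventuallyEq_zero hy] with z hz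
        rw [hz, zero_mul]
      have h0' : pd (cutoff P ρ) i y = 0 :=
        (pd_cutoff_eventuallyEq_zero hρ (fun h' => hy ⟨h'.1, by linarith [H.le]⟩) i).eq_of_nhds
      simp only [hF1, h0, h0', mul_zero, add_zero, abs_zero]
      positivity
  have key := hk (pd (pd (fun y => h y * annCutoff P ρ σ y) j) i) ((hψ.pd_one j).continuous_pd i)
    ((hψc.pd j).pd i) x
    (J * (A * η₃ + A * μ * q) + D * (M * ρ ^ (N - 1) * q)
      + Cz * (c * η₁) * (ρ ^ (N - 2) * ((‖x - P‖ / 2) ^ N)⁻¹)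
      + Cz * (c * η₂) * S) fun s hs => by
    have hK : ∀ k, ContDiff ℝ 2 (gradKer s k : EN N → ℝ) := fun k => contDiff_gradKer hs k
    have hW : ∀ k, ContDiff ℝ 1 (pd (gradKer s k : EN N → ℝ) i) := fun k => (hK k).pd_one i
    have hsum : ContDiff ℝ 1 fun z : EN N => ∑ k, pd (gradKer s k) k z :=
      ContDiff.sum fun k _ => (hK k).pd_one k
    have hpd : ∀ z : EN N, pd (fun z : EN N => ∑ k, pd (gradKer s k) k z) i z
        = ∑ k, pd (pd (gradKer s k) i) k z := by
      intro z
      have hf : HasFDerivAt (fun z : EN N => ∑ k, pd (gradKer s k) k z)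
          (∑ k, fderiv ℝ (pd (gradKer s k) k) z) z :=
        HasFDerivAt.fun_sum fun k _ =>
          (((hK k).pd_one k).differentiable (by norm_num) z).hasFDerivAt
      rw [pd_of_hasFDerivAt hf, _root_.sum_apply]
      exact Finset.sum_congr rfl fun k _ => pd2_comm (hK k).contDiffAt k i
    have hfun : ∀ a b, pd (gradKer s a : EN N → ℝ) b = pd (gradKer s b) a := fun a b =>
      funext fun z => pd_gradKer_comm hs b a z
    rw [← integral_pd_comp_sub_mul hsum (hψ.pd_one j) (hψc.pd j) x i]
    simp only [hpd]
    rw [integral_div_mul_pd hW (fun a b z => by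
      have t : ∀ a b, pd (pd (gradKer s a : EN N → ℝ) i) b z = pd (pd (gradKer s a) b) i z :=
        fun a b => pd2_comm (hK a).contDiffAt i b
      rw [t, t, hfun]) hψ hψc x j]
    have hb := hz P x h G (pd (gradKer s j) i) ρ σ η₁ η₂ η₃ μ c N H h1 h2 hc0.le (hW j)
      (fun z hz => (abs_pd_gradKer_le hs i j hz).trans
        (mul_le_mul_of_nonneg_right (by rw [hc]; nlinarith) (by positivity)))
      (fun k z hz => abs_pd_pd_gradKer_le hs i j k hz)
    have hi : Integrable fun y => gradKer s j (x - y) * pd (fun y => annCutoff P ρ σ y * G y) i y :=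
      integrable_comp_sub_mul (hK j).continuous (H.contDiff_mul_lap.continuous_pd i)
        (H.hasCompactSupport_mul_lap.pd i) x
    have hi2 : Integrable fun y => gradKer s j (x - y) * (G y * pd (cutoff P ρ) i y) :=
      integrable_comp_sub_mul (hK j).continuous hF2 hF2c x
    have e : ∫ y, pd (gradKer s j) i (x - y) * (annCutoff P ρ σ y * G y)
        = (∫ y, gradKer s j (x - y) * F1 y)
          - ∫ y, gradKer s j (x - y) * (G y * pd (cutoff P ρ) i y) := by
      rw [integral_pd_comp_sub_mul ((hK j).of_le (by norm_num)) H.contDiff_mul_lap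
        H.hasCompactSupport_mul_lap x i]
      have : (fun y => gradKer s j (x - y) * F1 y) = fun y =>
          gradKer s j (x - y) * pd (fun y => annCutoff P ρ σ y * G y) i y
            + gradKer s j (x - y) * (G y * pd (cutoff P ρ) i y) := by
        funext y
        simp only [hF1]
        ring
      rw [this, integral_add hi hi2, add_sub_cancel_right]
    have hs' := hj P x (gradKer s j) F1 (A * η₃) (A * μ) (by positivity) (by positivity)
      (fun e => by simp [e] at hr) (by linarith [H.le_one]) (abs_gradKer_le hs j)
      (fun y hy => by
        have hy' : 2 * σ < ‖y - P‖ := by linarith [H.le_one]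
        have h0 : pd (fun y => annCutoff P ρ σ y * G y) i y = 0 := by
          refine pd_eq_zero_of_eventuallyEq_const (c := 0) ?_ i
          filter_upwards [H.annCutoff_eventuallyEq_zero fun h => absurd h.2 (not_le.2 hy')]
            with z hz
          rw [hz, zero_mul]
        simp only [hF1, h0, (cutoff_derivatives_eq_zero hρ
          (show 2 * ρ < ‖y - P‖ by linarith [H.le])).1 i, mul_zero, add_zero])
      (fun y _ => hF1b y)
    have hs2 : |∫ y, gradKer s j (x - y) * (G y * pd (cutoff P ρ) i y)|
        ≤ 2 ^ (N - 1) * q * (M * (Cb * ρ⁻¹)) * ((2 * ρ) ^ N * v) := by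
      refine abs_integral_le_of_support_closedBall (P := P) (by positivity) (fun y hy => ?_)
        fun y hy => ?_
      · simp [(cutoff_derivatives_eq_zero hρ hy).1 i]
      · by_cases hy' : ρ ≤ ‖y - P‖
        · have hd : ‖x - P‖ / 2 ≤ ‖x - y‖ := by
            have := norm_sub_norm_le (x - P) (y - P)
            rw [sub_sub_sub_cancel_right] at this
            linarith
          have h3 : (‖x - y‖ ^ (N - 1))⁻¹ ≤ 2 ^ (N - 1) * q := by
            rw [hq, ← inv_half_pow]
            exact inv_anti₀ (by positivity) (pow_le_pow_left₀ (by positivity) hd _)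
          rw [abs_mul, abs_mul]
          exact mul_le_mul ((abs_gradKer_le hs j _).trans h3)
            (mul_le_mul (hGM y hy' hy) ((hcut P ρ hρ y).1 i) (abs_nonneg _) hM)
            (by positivity) (by positivity)
        · have : pd (cutoff P ρ) i y = 0 :=
            (pd_cutoff_eventuallyEq_zero hρ (fun h => hy' h.1) i).eq_of_nhds
          rw [this, mul_zero, mul_zero, abs_zero]
          positivity
    have e2 : 2 ^ (N - 1) * q * (M * (Cb * ρ⁻¹)) * ((2 * ρ) ^ N * v)
        = D * (M * ρ ^ (N - 1) * q) := by
      have : ρ ^ N = ρ ^ (N - 1) * ρ := by rw [← pow_succ]; congr 1; omega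
      rw [mul_pow, this, hD]
      field_simp
    rw [e2] at hs2
    have := abs_sub (∫ y, gradKer s j (x - y) * F1 y)
      (∫ y, gradKer s j (x - y) * (G y * pd (cutoff P ρ) i y))
    rw [← e] at this
    linarith
  have hx2 : pd (pd (fun y => h y * annCutoff P ρ σ y) j) i x = pd2 h j i x :=
    pd2_congr (H.mul_eventuallyEq h1 h2) j i
  rw [hx2] at key
  refine key.trans ?_
  rw [inv_half_pow, mul_assoc κ]
  refine mul_le_mul_of_nonneg_left ?_ hκ.le
  set p := (‖x - P‖ ^ N)⁻¹ with hp
  have hp0 : 0 < p := by positivity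
  set a := ρ ^ (N - 2) with ha
  set b := ρ ^ (N - 1) with hb
  have ha0 : 0 < a := by positivity
  have hb0 : 0 < b := by positivity
  have a1 : 0 ≤ J * A * (η₂ + M * b * q + η₁ * a * p) := by positivity
  have a2 : 0 ≤ D * (η₂ + η₃ + μ * q + η₁ * a * p) := by positivity
  have a3 : 0 ≤ Cz * c * 2 ^ N * (η₂ + η₃ + (M * b + μ) * q) := by positivity
  have a4 : 0 ≤ Cz * c * S * (η₃ + (M * b + μ) * q + η₁ * a * p) := by positivity
  linarith

end LocalEstimates

section MaximumPrinciple

variable {N : ℕ}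

theorem pd_comp_sub {u : EN N → ℝ} {P x : EN N} (i : Fin N)
    (hu : DifferentiableAt ℝ u (x - P)) :
    pd (fun y => u (y - P)) i x = pd u i (x - P) := by
  have := pd_comp_smul_sub u 1 P i x (by rwa [one_smul])
  simpa only [one_smul, one_mul] using this

theorem pd_coord_sub (P x : EN N) (i j : Fin N) :
    pd (fun y => y i - P i) j x = if j = i then 1 else 0 := by
  rw [pd_sub ((contDiff_coord i (n := 1)).differentiable (by norm_num) x)
    (differentiableAt_const _), pd_coord, pd_const, sub_zero]

theorem pd_norm_sub_sq (P x : EN N) (i : Fin N) :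
    pd (fun y => ‖y - P‖ ^ 2) i x = 2 * (x i - P i) := by
  rw [pd_comp_sub (u := fun z => ‖z‖ ^ 2) i
    ((contDiff_norm_sq ℝ (n := 1)).differentiable (by norm_num) _), pd_norm_sq]
  rfl

theorem contDiff_norm_sub_sq (P : EN N) {n : WithTop ℕ∞} :
    ContDiff ℝ n fun y : EN N => ‖y - P‖ ^ 2 :=
  (contDiff_norm_sq ℝ).comp (contDiff_id.sub contDiff_const)

theorem lap_norm_sub_sq (P x : EN N) : lap (fun y => ‖y - P‖ ^ 2) x = 2 * N := by
  have h : ∀ i, pd2 (fun y => ‖y - P‖ ^ 2) i i x = 2 := fun i => by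
    change pd (pd (fun y => ‖y - P‖ ^ 2) i) i x = 2
    rw [funext fun z => pd_norm_sub_sq P z i, pd_const_mul
      (((contDiff_coord i (n := 1)).sub contDiff_const).differentiable (by norm_num) x),
      pd_coord_sub, if_pos rfl, mul_one]
  simp [lap, h, mul_comm]

theorem deriv_comp_line {u : EN N → ℝ} {x : EN N} (i : Fin N) {t : ℝ}
    (hu : DifferentiableAt ℝ u (x + t • EuclideanSpace.single i 1)) :
    deriv (fun t : ℝ => u (x + t • EuclideanSpace.single i 1)) t
      = pd u i (x + t • EuclideanSpace.single i 1) := by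
  have h1 : HasDerivAt (fun t : ℝ => x + t • EuclideanSpace.single i (1:ℝ))
      (EuclideanSpace.single i 1) t := by
    simpa using ((hasDerivAt_id t).smul_const (EuclideanSpace.single i (1:ℝ))).const_add x
  exact (hu.hasFDerivAt.comp_hasDerivAt t h1).deriv

theorem pd2_nonpos_of_isLocalMax {h : EN N → ℝ} {x : EN N} (hh : ContDiffAt ℝ 2 h x)
    (hm : IsLocalMax h x) (i : Fin N) : pd2 h i i x ≤ 0 := by
  by_contra! hpos
  set ℓ : ℝ → EN N := fun t => x + t • EuclideanSpace.single i 1 with hℓ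
  have hℓc : Continuous ℓ := continuous_const.add (continuous_id.smul continuous_const)
  have hℓ0 : ℓ 0 = x := by simp [hℓ]
  have hT : Tendsto ℓ (𝓝 0) (𝓝 x) := by
    have := hℓc.tendsto 0
    rwa [hℓ0] at this
  have hd : deriv (h ∘ ℓ) =ᶠ[𝓝 0] (pd h i ∘ ℓ) := by
    filter_upwards [hT.eventually (hh.eventually (by norm_num))] with t ht
    exact deriv_comp_line i (ht.differentiableAt (by norm_num))
  have hdd : deriv (deriv (h ∘ ℓ)) 0 = pd2 h i i x := by
    rw [hd.deriv_eq]
    have h2 : DifferentiableAt ℝ (pd h i) (ℓ 0) := by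
      rw [hℓ0]
      exact (hh.pd_one i).differentiableAt (by norm_num)
    have := deriv_comp_line i h2
    rw [show x + (0:ℝ) • EuclideanSpace.single i (1:ℝ) = x by simp] at this
    exact this
  have hmax : IsLocalMax (h ∘ ℓ) 0 := by
    have := hT.eventually hm
    filter_upwards [this] with t ht
    simpa [hℓ0] using ht
  have hmin : IsLocalMin (h ∘ ℓ) 0 := by
    refine isLocalMin_of_deriv_deriv_pos (by rwa [hdd]) hmax.deriv_eq_zero ?_
    exact ContinuousAt.comp (by rw [hℓ0]; exact hh.continuousAt) hℓc.continuousAt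
  have hconst : h ∘ ℓ =ᶠ[𝓝 0] fun _ => (h ∘ ℓ) 0 := by
    filter_upwards [hmax, hmin] with t h1 h2 using le_antisymm h1 h2
  have h0 : deriv (h ∘ ℓ) =ᶠ[𝓝 0] fun _ => 0 := by
    filter_upwards [hconst.eventuallyEq_nhds] with t ht
    rw [ht.deriv_eq, deriv_const]
  rw [← hdd, h0.deriv_eq, deriv_const] at hpos
  exact lt_irrefl _ hpos

theorem lap_nonpos_of_isLocalMax {h : EN N → ℝ} {x : EN N} (hh : ContDiffAt ℝ 2 h x)
    (hm : IsLocalMax h x) : lap h x ≤ 0 :=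
  Finset.sum_nonpos fun i _ => pd2_nonpos_of_isLocalMax hh hm i

theorem isCompact_annulus (P : EN N) (ε R : ℝ) :
    IsCompact {y : EN N | ε ≤ ‖y - P‖ ∧ ‖y - P‖ ≤ R} := by
  refine (isCompact_closedBall P R).of_isClosed_subset ?_ fun y hy => by
    rw [mem_closedBall, dist_eq_norm]
    exact hy.2
  have hc : Continuous fun y : EN N => ‖y - P‖ := (continuous_id.sub continuous_const).norm
  exact (isClosed_le continuous_const hc).inter (isClosed_le hc continuous_const)

theorem nonpos_of_lap_pos {P : EN N} {ε R : ℝ} {v : EN N → ℝ}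
    (hc : ContinuousOn v {y | ε ≤ ‖y - P‖ ∧ ‖y - P‖ ≤ R})
    (h2 : ∀ y, ε < ‖y - P‖ → ‖y - P‖ < R → ContDiffAt ℝ 2 v y ∧ 0 < lap v y)
    (hε : ∀ y, ‖y - P‖ = ε → v y ≤ 0) (hR : ∀ y, ‖y - P‖ = R → v y ≤ 0) {y : EN N}
    (h1 : ε ≤ ‖y - P‖) (h1' : ‖y - P‖ ≤ R) : v y ≤ 0 := by
  obtain ⟨z, hz, hmax⟩ := (isCompact_annulus P ε R).exists_isMaxOn ⟨y, h1, h1'⟩ hc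
  refine (hmax ⟨h1, h1'⟩ : v y ≤ v z).trans ?_
  rcases hz.1.eq_or_lt with e | hlt
  · exact hε z e.symm
  rcases hz.2.eq_or_lt with e | hlt'
  · exact hR z e
  obtain ⟨hd, hp⟩ := h2 z hlt hlt'
  have hc' : Continuous fun y : EN N => ‖y - P‖ := (continuous_id.sub continuous_const).norm
  refine absurd (lap_nonpos_of_isLocalMax hd (hmax.isLocalMax ?_)) (not_le.2 hp)
  filter_upwards [hc'.continuousAt.eventually_const_lt hlt, hc'.continuousAt.eventually_lt_const hlt']
    with w a b using ⟨a.le, b.le⟩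

/-- Barrier estimate on an annulus, in terms of a harmonic capacitary function `Φ`. -/
theorem abs_le_of_barrier (hN : N ≠ 0) {P : EN N} {ε R a η M : ℝ} {h Φ : EN N → ℝ} (hM : 0 < M)
    (hη : 0 ≤ η)
    (ha : 0 ≤ a)
    (hc : ContinuousOn h {y | ε ≤ ‖y - P‖ ∧ ‖y - P‖ ≤ R})
    (h2 : ∀ y, ε < ‖y - P‖ → ‖y - P‖ < R → ContDiffAt ℝ 2 h y ∧ |lap h y| ≤ M)
    (hΦ : ∀ y, ε ≤ ‖y - P‖ → ContDiffAt ℝ 2 Φ y ∧ lap Φ y = 0)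
    (hΦε : ∀ y, ‖y - P‖ = ε → Φ y = 1) (hΦR : ∀ y, ‖y - P‖ = R → Φ y ≤ 1 / 2)
    (hbε : ∀ y, ‖y - P‖ = ε → |h y| ≤ a) (hbR : ∀ y, ‖y - P‖ = R → |h y| ≤ η) {y : EN N}
    (h1 : ε ≤ ‖y - P‖) (h1' : ‖y - P‖ ≤ R) :
    |h y| ≤ a + M * ε ^ 2 + 2 * (η + M * R ^ 2) * (1 - Φ y) := by
  have key : ∀ g : EN N → ℝ, ContinuousOn g {y | ε ≤ ‖y - P‖ ∧ ‖y - P‖ ≤ R} →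
      (∀ y, ε < ‖y - P‖ → ‖y - P‖ < R → ContDiffAt ℝ 2 g y ∧ |lap g y| ≤ M) →
      (∀ y, ‖y - P‖ = ε → |g y| ≤ a) → (∀ y, ‖y - P‖ = R → |g y| ≤ η) →
      g y ≤ a + M * ε ^ 2 + 2 * (η + M * R ^ 2) * (1 - Φ y) := by
    intro g hgc hg2 hgε hgR
    set b := 2 * (η + M * R ^ 2) with hb
    set v : EN N → ℝ := fun y =>
      (g y + b * Φ y) + (M * ‖y - P‖ ^ 2 + -(a + M * ε ^ 2 + b)) with hv
    have hMn : (0:ℝ) < M * N := by positivity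
    have hN1 : (1:ℝ) ≤ N := by exact_mod_cast Nat.one_le_iff_ne_zero.2 hN
    have hvy : v y ≤ 0 := by
      refine nonpos_of_lap_pos (v := v) (ε := ε) (R := R) (P := P) ?_ ?_ ?_ ?_ h1 h1'
      · refine (hgc.add (continuousOn_const.mul fun z hz =>
          (hΦ z hz.1).1.continuousAt.continuousWithinAt)).add ?_
        exact ((continuous_const.mul (contDiff_norm_sub_sq P (n := 0)).continuous).add
          continuous_const).continuousOn
      · intro z hz hz'
        obtain ⟨g2, gl⟩ := hg2 z hz hz'
        obtain ⟨Φ2, Φl⟩ := hΦ z hz.le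
        have q2 : ContDiffAt ℝ 2 (fun y : EN N => ‖y - P‖ ^ 2) z :=
          (contDiff_norm_sub_sq P).contDiffAt
        have c2 : ContDiffAt ℝ 2 (fun y : EN N => -(a + M * ε ^ 2 + b)) z := contDiffAt_const
        have s1 : ContDiffAt ℝ 2 (fun y => g y + b * Φ y) z := g2.add (contDiffAt_const.mul Φ2)
        have s2 : ContDiffAt ℝ 2 (fun y => M * ‖y - P‖ ^ 2 + -(a + M * ε ^ 2 + b)) z :=
          (contDiffAt_const.mul q2).add c2
        refine ⟨s1.add s2, ?_⟩
        rw [hv, lap_add s1 s2, lap_add g2 (contDiffAt_const.mul Φ2), lap_const_mul Φ2, Φl,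
          lap_add (contDiffAt_const.mul q2) c2, lap_const_mul q2, lap_norm_sub_sq, lap_const]
        have := neg_le_of_abs_le gl
        nlinarith
      · intro z hz
        have := le_of_abs_le (hgε z hz)
        simp only [hv, hΦε z hz, hz]
        linarith
      · intro z hz
        have h3 := le_of_abs_le (hgR z hz)
        have h4 := hΦR z hz
        simp only [hv, hz]
        have hb0 : 0 ≤ b := by positivity
        have : b * Φ z ≤ b * (1 / 2) := mul_le_mul_of_nonneg_left h4 hb0
        have hε2 : 0 ≤ M * ε ^ 2 := by positivity
        linarith
    have hy2 : 0 ≤ M * ‖y - P‖ ^ 2 := by positivity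
    simp only [hv] at hvy
    linarith
  refine abs_le.2 ⟨?_, key h hc h2 hbε hbR⟩
  have hn : ∀ z, -h z = (-1) * h z := fun z => (neg_one_mul _).symm
  have := key (fun z => (-1) * h z) (continuousOn_const.mul hc)
    (fun z hz hz' => ⟨contDiffAt_const.mul (h2 z hz hz').1, by
      rw [lap_const_mul (h2 z hz hz').1, neg_one_mul, abs_neg]
      exact (h2 z hz hz').2⟩)
    (fun z hz => by rw [← hn, abs_neg]; exact hbε z hz)
    (fun z hz => by rw [← hn, abs_neg]; exact hbR z hz)
  linarith

end MaximumPrinciple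

section Capacitary

variable {N : ℕ}

theorem norm_sub_pos' {P y : EN N} (hy : y ≠ P) : 0 < ‖y - P‖ :=
  norm_pos_iff.2 (sub_ne_zero.2 hy)

theorem contDiffAt_norm_sub {P y : EN N} (hy : y ≠ P) {n : WithTop ℕ∞} :
    ContDiffAt ℝ n (fun z => ‖z - P‖) y :=
  (contDiffAt_norm ℝ (sub_ne_zero.2 hy)).comp y (contDiffAt_id.sub contDiffAt_const)

theorem pd_norm_sub {P y : EN N} (hy : y ≠ P) (i : Fin N) :
    pd (fun z => ‖z - P‖) i y = (y i - P i) / ‖y - P‖ := by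
  have hr := norm_sub_pos' hy
  have h1 : DifferentiableAt ℝ (fun z => ‖z - P‖) y :=
    (contDiffAt_norm_sub hy (n := 1)).differentiableAt (by norm_num)
  have h2 := pd_mul h1 h1 i
  have h3 : pd (fun z => ‖z - P‖ * ‖z - P‖) i y = 2 * (y i - P i) := by
    rw [← pd_norm_sub_sq]
    simp only [pow_two]
  rw [eq_div_iff hr.ne']
  linarith

theorem pd_norm_sub_comp {P y : EN N} (hy : y ≠ P) {g : ℝ → ℝ} {g' : ℝ}
    (hg : HasDerivAt g g' ‖y - P‖) (i : Fin N) :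
    pd (fun z => g ‖z - P‖) i y = g' * ((y i - P i) / ‖y - P‖) := by
  have hn : DifferentiableAt ℝ (fun z => ‖z - P‖) y :=
    (contDiffAt_norm_sub hy (n := 1)).differentiableAt (by norm_num)
  rw [pd_comp (u := fun z => ‖z - P‖) hg.differentiableAt hn, hg.deriv, pd_norm_sub hy]

theorem pd_inv_norm_sub_pow {P y : EN N} (hy : y ≠ P) (m : ℕ) (i : Fin N) :
    pd (fun z => (‖z - P‖ ^ m)⁻¹) i y = -(m * ((y i - P i) * (‖y - P‖ ^ (m + 2))⁻¹)) := by
  have hr := norm_sub_pos' hy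
  rw [pd_norm_sub_comp hy (g := fun t => (t ^ m)⁻¹)
    ((hasDerivAt_pow m ‖y - P‖).inv (pow_pos hr m).ne')]
  rcases m with _ | m
  · simp
  · simp only [Nat.add_sub_cancel]
    field_simp
    ring

theorem differentiableAt_inv_norm_sub_pow {P y : EN N} (hy : y ≠ P) (m : ℕ) :
    DifferentiableAt ℝ (fun z => (‖z - P‖ ^ m)⁻¹) y :=
  (((contDiffAt_norm_sub hy (n := 1)).pow m).inv
    (pow_pos (norm_sub_pos' hy) m).ne').differentiableAt (by norm_num)

/-- `Φ` behaves like the capacitary potential of the ball `B(P,ε)`. -/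
structure IsCapacitary (P : EN N) (Φ : EN N → ℝ) (ε c μ B : ℝ) : Prop where
  pos : 0 < ε
  pos' : 0 < μ
  contDiffAt : ∀ y, y ≠ P → ContDiffAt ℝ 2 Φ y
  pd_eq : ∀ y, y ≠ P → ∀ i, pd Φ i y = -(c * μ) * ((y i - P i) * (‖y - P‖ ^ N)⁻¹)
  eq_one : ∀ y, ‖y - P‖ = ε → Φ y = 1
  nonneg : ∀ y, ε ≤ ‖y - P‖ → ‖y - P‖ ≤ 1 → 0 ≤ Φ y
  le : ∀ y, ε ≤ ‖y - P‖ → ‖y - P‖ ≤ 1 → Φ y ≤ μ * (‖y - P‖ ^ (N - 1))⁻¹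
  one_sub_le : ∀ y, ε ≤ ‖y - P‖ → ‖y - P‖ ≤ 32 * ε → (1 - Φ y) * ε ^ (N - 2) ≤ B * μ
  le_one : ∀ y, ε ≤ ‖y - P‖ → Φ y ≤ 1

namespace IsCapacitary

variable {P : EN N} {Φ : EN N → ℝ} {ε c μ B : ℝ}

theorem pd2_eq (H : IsCapacitary P Φ ε c μ B) {y : EN N} (hy : y ≠ P) (i j : Fin N) :
    pd2 Φ i j y = -(c * μ) * ((if i = j then 1 else 0) * (‖y - P‖ ^ N)⁻¹
      - N * (y i - P i) * (y j - P j) * (‖y - P‖ ^ (N + 2))⁻¹) := by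
  have he : pd Φ i =ᶠ[𝓝 y] fun y => -(c * μ) * ((y i - P i) * (‖y - P‖ ^ N)⁻¹) := by
    filter_upwards [isOpen_ne.mem_nhds hy] with z hz using H.pd_eq z hz i
  have h1 : DifferentiableAt ℝ (fun z : EN N => z i - P i) y :=
    ((contDiff_coord i (n := 1)).sub contDiff_const).differentiable (by norm_num) y
  have h2 := differentiableAt_inv_norm_sub_pow hy N
  have h3 : DifferentiableAt ℝ (fun z : EN N => (z i - P i) * (‖z - P‖ ^ N)⁻¹) y := h1.mul h2
  change pd (pd Φ i) j y = _
  rw [pd_congr he, pd_const_mul h3, pd_mul h1 h2, pd_inv_norm_sub_pow hy, pd_coord_sub]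
  simp only [eq_comm (a := j) (b := i)]
  ring

theorem lap_eq_zero (H : IsCapacitary P Φ ε c μ B) {y : EN N} (hy : y ≠ P) : lap Φ y = 0 := by
  have hr := norm_sub_pos' hy
  have hs : ∑ i, (y i - P i) * (y i - P i) = ‖y - P‖ ^ 2 := by
    rw [EuclideanSpace.real_norm_sq_eq]
    exact Finset.sum_congr rfl fun i _ => (pow_two _).symm
  have hs' : ∑ i, N * (y i - P i) * (y i - P i) * (‖y - P‖ ^ (N + 2))⁻¹
      = N * (‖y - P‖ ^ N)⁻¹ := by
    rw [← Finset.sum_mul]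
    simp only [mul_assoc]
    rw [← Finset.mul_sum, hs, pow_add]
    field_simp
  simp only [lap, H.pd2_eq hy, if_true, one_mul]
  rw [← Finset.mul_sum, Finset.sum_sub_distrib, hs']
  simp

theorem ne_of_le (H : IsCapacitary P Φ ε c μ B) {y : EN N} (hy : ε ≤ ‖y - P‖) : y ≠ P :=
  sub_ne_zero.1 (norm_pos_iff.1 (H.pos.trans_le hy))

theorem abs_pd_le (H : IsCapacitary P Φ ε c μ B) (hN : N ≠ 0) (hc : 0 ≤ c) {y : EN N}
    (hy : ε ≤ ‖y - P‖) (i : Fin N) : |pd Φ i y| ≤ c * μ * (‖y - P‖ ^ (N - 1))⁻¹ := by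
  have hr : 0 < ‖y - P‖ := H.pos.trans_le hy
  have hμ := H.pos'
  rw [H.pd_eq y (H.ne_of_le hy), abs_mul, abs_neg, abs_of_nonneg (by positivity : 0 ≤ c * μ)]
  refine mul_le_mul_of_nonneg_left ?_ (by positivity)
  rw [abs_mul, abs_of_nonneg (by positivity : 0 ≤ (‖y - P‖ ^ N)⁻¹)]
  have e : (‖y - P‖ ^ (N - 1))⁻¹ = ‖y - P‖ * (‖y - P‖ ^ N)⁻¹ := by
    obtain ⟨n, rfl⟩ := Nat.exists_eq_succ_of_ne_zero hN
    simp only [Nat.succ_eq_add_one, Nat.add_sub_cancel, pow_succ]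
    field_simp
  rw [e]
  exact mul_le_mul_of_nonneg_right (abs_apply_le_norm (y - P) i) (by positivity)

end IsCapacitary

theorem isCapacitary_pow (hN : 3 ≤ N) (P : EN N) {ε : ℝ} (hε : 0 < ε) :
    IsCapacitary P (fun y => ε ^ (N - 2) * (‖y - P‖ ^ (N - 2))⁻¹) ε ((N : ℝ) - 2)
      (ε ^ (N - 2)) 1 where
  pos := hε
  pos' := by positivity
  contDiffAt y hy := contDiffAt_const.mul
    (((contDiffAt_norm_sub hy).pow _).inv (pow_pos (norm_sub_pos' hy) _).ne')
  pd_eq y hy i := by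
    rw [pd_const_mul (differentiableAt_inv_norm_sub_pow hy (N - 2)),
      pd_inv_norm_sub_pow hy, show N - 2 + 2 = N by omega, Nat.cast_sub (by omega)]
    push_cast
    ring
  eq_one y hy := by
    rw [hy, mul_inv_cancel₀ (by positivity)]
  nonneg y _ _ := by positivity
  le y hy hy' := by
    have hr : 0 < ‖y - P‖ := hε.trans_le hy
    gcongr 1
    exact inv_anti₀ (by positivity) (pow_le_pow_of_le_one hr.le hy' (by omega))
  one_sub_le y _ _ := by
    have : 0 ≤ ε ^ (N - 2) * (‖y - P‖ ^ (N - 2))⁻¹ := by positivity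
    exact mul_le_mul_of_nonneg_right (by linarith) (by positivity)
  le_one y hy := by
    rw [← div_eq_mul_inv, div_le_one (pow_pos (hε.trans_le hy) _)]
    exact pow_le_pow_left₀ hε.le hy _

theorem isCapacitary_log (P : EN 2) {ε : ℝ} (hε : 0 < ε) (hε1 : ε < 1) :
    IsCapacitary P (fun y => (Real.log ε)⁻¹ * Real.log ‖y - P‖) ε 1 |Real.log ε|⁻¹
      (Real.log 32) := by
  have hl : Real.log ε < 0 := Real.log_neg hε hε1
  have ha : |Real.log ε|⁻¹ = -(Real.log ε)⁻¹ := by rw [abs_of_neg hl, inv_neg]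
  have hp : 0 < |Real.log ε|⁻¹ := inv_pos.2 (abs_pos.2 hl.ne)
  refine ⟨hε, hp, fun y hy => ?_, fun y hy i => ?_, fun y hy => ?_, fun y hy hy' => ?_,
    fun y hy hy' => ?_, fun y hy hy' => ?_, fun y hy => ?_⟩
  · exact contDiffAt_const.mul ((contDiffAt_norm_sub hy).log (norm_sub_pos' hy).ne')
  · have hr := norm_sub_pos' hy
    rw [pd_const_mul (((contDiffAt_norm_sub hy (n := 1)).log hr.ne').differentiableAt
      (by norm_num)), pd_norm_sub_comp hy (Real.hasDerivAt_log hr.ne'), ha]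
    field_simp
  · rw [hy, inv_mul_cancel₀ hl.ne]
  · exact mul_nonneg_of_nonpos_of_nonpos (inv_nonpos.2 hl.le)
      (Real.log_nonpos (norm_nonneg _) hy')
  · have hr : 0 < ‖y - P‖ := hε.trans_le hy
    have h1 : -Real.log ‖y - P‖ ≤ ‖y - P‖⁻¹ := by
      rw [← Real.log_inv]
      exact (Real.log_le_sub_one_of_pos (inv_pos.2 hr)).trans (by linarith)
    have h2 := mul_le_mul_of_nonneg_left h1 hp.le
    rw [show 2 - 1 = 1 from rfl, pow_one]
    rw [ha] at h2 ⊢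
    linarith
  · have hr : 0 < ‖y - P‖ := hε.trans_le hy
    have h1 : Real.log ‖y - P‖ ≤ Real.log 32 + Real.log ε := by
      rw [← Real.log_mul (by norm_num) hε.ne']
      exact Real.log_le_log hr hy'
    have h2 := mul_le_mul_of_nonneg_right h1 hp.le
    have h3 : (Real.log ε)⁻¹ * Real.log ε = 1 := inv_mul_cancel₀ hl.ne
    rw [show 2 - 2 = 0 from rfl, pow_zero, mul_one]
    rw [ha] at h2 ⊢
    linarith
  · rw [← div_eq_inv_mul, div_le_one_of_neg hl]
    exact Real.log_le_log hε hy

end Capacitary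

section Perturbation

variable {N : ℕ}

/-- `v` solves `-Δv = f(v)` in `ε < |y - P| ≤ R`, is bounded by `A`, and vanishes on the inner
sphere. -/
structure IsLocalSol (P : EN N) (f : ℝ → ℝ) (v : EN N → ℝ) (ε R A : ℝ) : Prop where
  contDiffAt : ∀ y, ε < ‖y - P‖ → ‖y - P‖ ≤ R → ContDiffAt ℝ 2 v y
  lap_eq : ∀ y, ε < ‖y - P‖ → ‖y - P‖ ≤ R → lap v y = -f (v y)
  abs_le : ∀ y, ε < ‖y - P‖ → ‖y - P‖ ≤ R → |v y| ≤ A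
  continuousOn : ContinuousOn v {y | ε ≤ ‖y - P‖ ∧ ‖y - P‖ ≤ R}
  eq_zero : ∀ y, ‖y - P‖ = ε → v y = 0

/-- Quantitative local form of the convergence of solutions in perforated balls to `u₀`. -/
structure IsLocalApprox (P : EN N) (f : ℝ → ℝ) (u : ℝ → EN N → ℝ) (u₀ : EN N → ℝ)
    (R A L : ℝ) : Prop where
  pos : 0 < R
  le_one : R ≤ 1
  bound_nonneg : 0 ≤ A
  lip_nonneg : 0 ≤ L
  contDiff_f : ContDiff ℝ 2 f
  lip : ∀ s t, |s| ≤ A → |t| ≤ A → |f s - f t| ≤ L * |s - t|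
  deriv_le : ∀ s, |s| ≤ A → |deriv f s| ≤ L
  deriv_lip : ∀ s t, |s| ≤ A → |t| ≤ A → |deriv f s - deriv f t| ≤ L * |s - t|
  limit_contDiffAt : ∀ y, ‖y - P‖ ≤ R → ContDiffAt ℝ 2 u₀ y
  limit_lap : ∀ y, ‖y - P‖ ≤ R → lap u₀ y = -f (u₀ y)
  limit_abs_le : ∀ y, ‖y - P‖ ≤ R → |u₀ y| ≤ A
  limit_pd_le : ∀ y, ‖y - P‖ ≤ R → ∀ k, |pd u₀ k y| ≤ L
  limit_lip : ∀ y, ‖y - P‖ ≤ R → |u₀ P - u₀ y| ≤ L * ‖y - P‖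
  limit_nonneg : 0 ≤ u₀ P
  limit_le : u₀ P ≤ L
  eventually_sol : ∀ᶠ ε in 𝓝[>] (0:ℝ), IsLocalSol P f (u ε) ε R A
  eventually_near : ∀ r > 0, ∀ η > 0, ∀ᶠ ε in 𝓝[>] (0:ℝ), ∀ y, r ≤ ‖y - P‖ → ‖y - P‖ ≤ R →
    |u ε y - u₀ y| ≤ η ∧ ∀ k, |pd (u ε) k y - pd u₀ k y| ≤ η

/-- The difference of the two solutions, corrected by the capacitary potential. -/
def corrected (P : EN N) (v u₀ Φ : EN N → ℝ) (y : EN N) : ℝ := (v y - u₀ y) + u₀ P * Φ y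

namespace IsLocalApprox

variable {P : EN N} {f : ℝ → ℝ} {u : ℝ → EN N → ℝ} {u₀ : EN N → ℝ} {R A L : ℝ}
  {Φ : ℝ → EN N → ℝ} {μ : ℝ → ℝ} {c B : ℝ}

theorem corrected_pde (H : IsLocalApprox P f u u₀ R A L) {ε m : ℝ}
    (hs : IsLocalSol P f (u ε) ε R A) (hΦ : IsCapacitary P (Φ ε) ε c m B) {y : EN N}
    (h1 : ε < ‖y - P‖) (h2 : ‖y - P‖ ≤ R) :
    ContDiffAt ℝ 2 (corrected P (u ε) u₀ (Φ ε)) y ∧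
      lap (corrected P (u ε) u₀ (Φ ε)) y = f (u₀ y) - f (u ε y) ∧
      ContDiffAt ℝ 1 (fun y => f (u₀ y) - f (u ε y)) y ∧
      |f (u₀ y) - f (u ε y)| ≤ L * |u ε y - u₀ y| := by
  have a1 := hs.contDiffAt y h1 h2
  have a2 := H.limit_contDiffAt y h2
  have a3 := hΦ.contDiffAt y (hΦ.ne_of_le h1.le)
  have b1 : ContDiffAt ℝ 2 (fun y => u ε y - u₀ y) y := a1.sub a2
  have b2 : ContDiffAt ℝ 2 (fun y => u₀ P * Φ ε y) y := contDiffAt_const.mul a3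
  refine ⟨b1.add b2, ?_, ?_, ?_⟩
  · refine (lap_add b1 b2).trans ?_
    rw [lap_sub a1 a2, lap_const_mul a3, hΦ.lap_eq_zero (hΦ.ne_of_le h1.le), hs.lap_eq y h1 h2,
      H.limit_lap y h2]
    ring
  · exact ((H.contDiff_f.contDiffAt.comp y a2).sub (H.contDiff_f.contDiffAt.comp y a1)).of_le
      (by norm_num)
  · rw [abs_sub_comm (u ε y)]
    exact H.lip _ _ (H.limit_abs_le y h2) (hs.abs_le y h1 h2)

theorem pd_rhs_le (H : IsLocalApprox P f u u₀ R A L) {ε : ℝ}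
    (hs : IsLocalSol P f (u ε) ε R A) {y : EN N} (h1 : ε < ‖y - P‖) (h2 : ‖y - P‖ ≤ R)
    (k : Fin N) : |pd (fun y => f (u₀ y) - f (u ε y)) k y|
      ≤ L * |pd (u ε) k y - pd u₀ k y| + L * L * |u ε y - u₀ y| := by
  have a1 := (hs.contDiffAt y h1 h2).differentiableAt (by norm_num)
  have a2 := (H.limit_contDiffAt y h2).differentiableAt (by norm_num)
  have hf : Differentiable ℝ f := H.contDiff_f.differentiable (by norm_num)
  have d1 : DifferentiableAt ℝ (fun y => f (u ε y)) y := (hf _).comp y a1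
  have d2 : DifferentiableAt ℝ (fun y => f (u₀ y)) y := (hf _).comp y a2
  rw [pd_sub d2 d1, pd_comp (hf _) a1, pd_comp (hf _) a2]
  have hL := H.lip_nonneg
  have e : deriv f (u₀ y) * pd u₀ k y - deriv f (u ε y) * pd (u ε) k y
      = -(deriv f (u ε y) * (pd (u ε) k y - pd u₀ k y))
        + -((deriv f (u ε y) - deriv f (u₀ y)) * pd u₀ k y) := by ring
  have t1 := mul_le_mul_of_nonneg_right (H.deriv_le _ (hs.abs_le y h1 h2))
    (abs_nonneg (pd (u ε) k y - pd u₀ k y))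
  have t2 := mul_le_mul (H.deriv_lip _ _ (hs.abs_le y h1 h2) (H.limit_abs_le y h2))
    (H.limit_pd_le y h2 k) (abs_nonneg _) (by positivity)
  rw [e]
  refine (abs_add_le _ _).trans ?_
  rw [abs_neg, abs_neg, abs_mul, abs_mul]
  linarith

theorem eventually_capacity_small (H : IsLocalApprox P f u u₀ R A L)
    (hΦ : ∀ᶠ ε in 𝓝[>] (0:ℝ), IsCapacitary P (Φ ε) ε c (μ ε) B)
    (hμ : Tendsto μ (𝓝[>] 0) (𝓝 0)) {r η : ℝ} (hr : 0 < r) (hη : 0 < η) :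
    ∀ᶠ ε in 𝓝[>] (0:ℝ), ∀ y, r ≤ ‖y - P‖ → ‖y - P‖ ≤ R → 0 ≤ Φ ε y ∧ Φ ε y ≤ η := by
  have hm : ∀ᶠ ε in 𝓝[>] (0:ℝ), μ ε * (r ^ (N - 1))⁻¹ < η := by
    have := hμ.mul_const (r ^ (N - 1))⁻¹
    rw [zero_mul] at this
    exact this.eventually_lt_const hη
  have hr' : ∀ᶠ ε in 𝓝[>] (0:ℝ), ε < r :=
    (tendsto_nhdsWithin_of_tendsto_nhds tendsto_id).eventually_lt_const hr
  filter_upwards [hΦ, hm, hr'] with ε h1 h2 h3 y hy hy'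
  have hy1 := hy'.trans H.le_one
  refine ⟨h1.nonneg y (h3.le.trans hy) hy1, (h1.le y (h3.le.trans hy) hy1).trans
    (le_trans ?_ h2.le)⟩
  exact mul_le_mul_of_nonneg_left (inv_anti₀ (by positivity) (pow_le_pow_left₀ hr.le hy _))
    h1.pos'.le

theorem eventually_corrected_small (hN : 2 ≤ N) (H : IsLocalApprox P f u u₀ R A L) (hB : 0 ≤ B)
    (hΦ : ∀ᶠ ε in 𝓝[>] (0:ℝ), IsCapacitary P (Φ ε) ε c (μ ε) B)
    (hμ : Tendsto μ (𝓝[>] 0) (𝓝 0)) (hμ' : Tendsto (fun ε => ε ^ (N - 1) / μ ε) (𝓝[>] 0) (𝓝 0))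
    {η : ℝ} (hη : 0 < η) :
    ∀ᶠ ε in 𝓝[>] (0:ℝ),
      (∀ y, ε ≤ ‖y - P‖ → ‖y - P‖ ≤ R → |corrected P (u ε) u₀ (Φ ε) y| ≤ η) ∧
      (∀ y, ε ≤ ‖y - P‖ → ‖y - P‖ ≤ 32 * ε →
        |corrected P (u ε) u₀ (Φ ε) y| * ε ^ (N - 2) ≤ η * μ ε) := by
  have hL := H.lip_nonneg
  have hA := H.bound_nonneg
  set M : ℝ := L * (2 * A) + 1 with hM
  have hM0 : 0 < M := by positivity
  set θ : ℝ := η / (7 + 6 * B) with hθ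
  have hθ0 : 0 < θ := by positivity
  have hθη : θ * (7 + 6 * B) = η := div_mul_cancel₀ _ (by positivity)
  obtain ⟨r, hr, hrR, hrθ⟩ : ∃ r > 0, r ≤ R ∧ M * r ^ 2 ≤ θ := by
    refine ⟨min R (min 1 (θ / M)), lt_min H.pos (lt_min one_pos (by positivity)),
      min_le_left _ _, ?_⟩
    set r := min R (min 1 (θ / M)) with hr
    have h0 : 0 < r := lt_min H.pos (lt_min one_pos (by positivity))
    have h1 : r ≤ 1 := (min_le_right _ _).trans (min_le_left _ _)
    have h2 : r ≤ θ / M := (min_le_right _ _).trans (min_le_right _ _)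
    rw [le_div_iff₀ hM0] at h2
    nlinarith
  have htend : Tendsto (fun ε : ℝ => ε) (𝓝[>] 0) (𝓝 0) :=
    tendsto_nhdsWithin_of_tendsto_nhds tendsto_id
  have hε1 : ∀ᶠ ε in 𝓝[>] (0:ℝ), (L + M) * ε < θ := by
    have := htend.const_mul (L + M)
    rw [mul_zero] at this
    exact this.eventually_lt_const hθ0
  have hε2 : ∀ᶠ ε in 𝓝[>] (0:ℝ), (L + M) * (ε ^ (N - 1) / μ ε) < θ := by
    have := hμ'.const_mul (L + M)
    rw [mul_zero] at this
    exact this.eventually_lt_const hθ0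
  have hε3 : ∀ᶠ ε in 𝓝[>] (0:ℝ), 32 * ε < r := by
    have := htend.const_mul 32
    rw [mul_zero] at this
    exact this.eventually_lt_const hr
  have hκ0 : 0 < min (1 / 2) (θ / (L + 1)) := lt_min (by norm_num) (by positivity)
  filter_upwards [H.eventually_sol, hΦ, H.eventually_near r hr θ hθ0,
    H.eventually_capacity_small hΦ hμ hr hκ0, hε1, hε2, hε3] with ε hs hcap hnear hsm e1 e2 e3
  have hε := hcap.pos
  have hμε := hcap.pos'
  have hfar : ∀ y, r ≤ ‖y - P‖ → ‖y - P‖ ≤ R → |corrected P (u ε) u₀ (Φ ε) y| ≤ 2 * θ := by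
    intro y h1 h2
    obtain ⟨p1, p2⟩ := hsm y h1 h2
    have p3 : Φ ε y ≤ θ / (L + 1) := p2.trans (min_le_right _ _)
    rw [le_div_iff₀ (by positivity)] at p3
    have p4 : u₀ P * Φ ε y ≤ θ := by
      have := mul_le_mul_of_nonneg_right H.limit_le p1
      linarith
    refine (abs_add_le _ _).trans ?_
    rw [abs_of_nonneg (mul_nonneg H.limit_nonneg p1)]
    linarith [(hnear y h1 h2).1]
  have hin : ∀ y, ε ≤ ‖y - P‖ → ‖y - P‖ ≤ r → |corrected P (u ε) u₀ (Φ ε) y|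
      ≤ L * ε + M * ε ^ 2 + 2 * (2 * θ + M * r ^ 2) * (1 - Φ ε y) := by
    intro y h1 h2
    refine abs_le_of_barrier (P := P) (h := corrected P (u ε) u₀ (Φ ε)) (by omega) hM0
      (by positivity) (by positivity) ?_ (fun z hz hz' => ?_) (fun z hz => ?_) hcap.eq_one
      (fun z hz => (hsm z hz.ge (hz.le.trans hrR)).2.trans (min_le_left _ _)) (fun z hz => ?_)
      (fun z hz => hfar z hz.ge (hz.le.trans hrR)) h1 h2
    · refine ((hs.continuousOn.mono fun z hz => ⟨hz.1, hz.2.trans hrR⟩).sub fun z hz =>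
        (H.limit_contDiffAt z (hz.2.trans hrR)).continuousAt.continuousWithinAt).add
        (continuousOn_const.mul fun z hz =>
          (hcap.contDiffAt z (hcap.ne_of_le hz.1)).continuousAt.continuousWithinAt)
    · obtain ⟨q1, q2, -, q3⟩ := H.corrected_pde hs hcap hz (hz'.le.trans hrR)
      refine ⟨q1, ?_⟩
      rw [q2]
      have s1 := hs.abs_le z hz (hz'.le.trans hrR)
      have s2 := H.limit_abs_le z (hz'.le.trans hrR)
      have s3 := mul_le_mul_of_nonneg_left ((abs_sub (u ε z) (u₀ z)).trans (add_le_add s1 s2)) hL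
      rw [hM]
      linarith
    · exact ⟨hcap.contDiffAt z (hcap.ne_of_le hz), hcap.lap_eq_zero (hcap.ne_of_le hz)⟩
    · rw [corrected, hs.eq_zero z hz, hcap.eq_one z hz, mul_one, zero_sub, neg_add_eq_sub, ← hz]
      exact H.limit_lip z (by linarith)
  have hε1' : ε ≤ 1 := by linarith [H.le_one]
  have hεsq : M * ε ^ 2 ≤ M * ε := by nlinarith [mul_nonneg hM0.le hε.le]
  have hin' : ∀ y, ε ≤ ‖y - P‖ → ‖y - P‖ ≤ r → |corrected P (u ε) u₀ (Φ ε) y|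
      ≤ (L + M) * ε + 6 * θ * (1 - Φ ε y) ∧ 0 ≤ Φ ε y := by
    intro y h1 h2
    have q0 := hcap.nonneg y h1 (by linarith [H.le_one])
    have q1 := hin y h1 h2
    refine ⟨?_, q0⟩
    have hq := hcap.le_one y h1
    have : 2 * (2 * θ + M * r ^ 2) * (1 - Φ ε y) ≤ 6 * θ * (1 - Φ ε y) :=
      mul_le_mul_of_nonneg_right (by linarith) (by linarith)
    linarith
  refine ⟨fun y h1 h2 => ?_, fun y h1 h2 => ?_⟩
  · rcases le_total ‖y - P‖ r with h | h
    · obtain ⟨q1, q2⟩ := hin' y h1 h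
      have : 6 * θ * (1 - Φ ε y) ≤ 6 * θ := mul_le_of_le_one_right (by positivity) (by linarith)
      nlinarith
    · have := hfar y h h2
      nlinarith
  · obtain ⟨q1, -⟩ := hin' y h1 (by linarith)
    have q2 := hcap.one_sub_le y h1 h2
    have hp : 0 ≤ ε ^ (N - 2) := by positivity
    have q3 := mul_le_mul_of_nonneg_right q1 hp
    have q4 := mul_le_mul_of_nonneg_left q2 (by positivity : 0 ≤ 6 * θ)
    have e4 : ε ^ (N - 1) = ε * ε ^ (N - 2) := by
      rw [← pow_succ']; congr 1; omega
    rw [← mul_div_assoc, div_lt_iff₀ hμε, e4] at e2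
    have : θ * μ ε + 6 * θ * (B * μ ε) ≤ η * μ ε := by
      rw [← hθη]
      have : 0 ≤ θ * μ ε := by positivity
      linarith
    linarith

theorem abs_sub_le_of_corrected (H : IsLocalApprox P f u u₀ R A L) {ε m η : ℝ}
    (hΦ : IsCapacitary P (Φ ε) ε c m B) {y : EN N} (h1 : ε ≤ ‖y - P‖) (h2 : ‖y - P‖ ≤ R)
    (h : |corrected P (u ε) u₀ (Φ ε) y| ≤ η) :
    |u ε y - u₀ y| ≤ η + L * m * (‖y - P‖ ^ (N - 1))⁻¹ := by
  have e : u ε y - u₀ y = corrected P (u ε) u₀ (Φ ε) y - u₀ P * Φ ε y := by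
    rw [corrected]; ring
  have h3 := hΦ.nonneg y h1 (h2.trans H.le_one)
  have h4 := hΦ.le y h1 (h2.trans H.le_one)
  have h5 := mul_le_mul H.limit_le h4 h3 H.lip_nonneg
  rw [e]
  refine (abs_sub _ _).trans ?_
  rw [abs_of_nonneg (mul_nonneg H.limit_nonneg h3)]
  linarith

theorem annulusBounds (H : IsLocalApprox P f u u₀ R A L) {ε m η k η₃ m' : ℝ}
    (hs : IsLocalSol P f (u ε) ε R A) (hΦ : IsCapacitary P (Φ ε) ε c m B) (hη : 0 ≤ η)
    (hc1 : ∀ y, ε ≤ ‖y - P‖ → ‖y - P‖ ≤ R → |corrected P (u ε) u₀ (Φ ε) y| ≤ η)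
    (hc2 : ∀ y, ε ≤ ‖y - P‖ → ‖y - P‖ ≤ 32 * ε →
      |corrected P (u ε) u₀ (Φ ε) y| * ε ^ (N - 2) ≤ η * m)
    (hk : 2 ≤ k) (hk' : k ≤ 16) (hε : 512 * ε ≤ R) (hη₃ : L * η ≤ η₃) (hm' : L * L * m ≤ m') :
    AnnulusBounds P (corrected P (u ε) u₀ (Φ ε)) (fun y => f (u₀ y) - f (u ε y)) (k * ε) (R / 4)
      (η * m / ε ^ (N - 2)) η η₃ m' := by
  have hε0 := hΦ.pos
  have hm := hΦ.pos'
  have hL := H.lip_nonneg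
  have hR := H.pos
  have hR1 := H.le_one
  have hkε : 2 * ε ≤ k * ε := mul_le_mul_of_nonneg_right hk hε0.le
  have hkε' : k * ε ≤ 16 * ε := mul_le_mul_of_nonneg_right hk' hε0.le
  have key : ∀ y, k * ε ≤ ‖y - P‖ → ‖y - P‖ ≤ 2 * (R / 4) → _ := fun y h1 h2 =>
    H.corrected_pde hs hΦ (y := y) (by linarith) (by linarith)
  refine ⟨by linarith, by linarith, by linarith, by positivity, hη,
    le_trans (by positivity) hη₃, le_trans (by positivity) hm', fun y h1 h2 => (key y h1 h2).1,
    fun y h1 h2 => (key y h1 h2).2.2.1, fun y h1 h2 => (key y h1 h2).2.1, fun y h1 h2 => ?_,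
    fun y h1 h2 => ?_, fun y h1 h2 => hc1 y (by linarith) (by linarith)⟩
  · have h3 := H.abs_sub_le_of_corrected hΦ (y := y) (by linarith) (by linarith)
      (hc1 y (by linarith) (by linarith))
    have h4 := mul_le_mul_of_nonneg_left h3 hL
    have h5 : L * L * m * (‖y - P‖ ^ (N - 1))⁻¹ ≤ m' * (‖y - P‖ ^ (N - 1))⁻¹ :=
      mul_le_mul_of_nonneg_right hm' (by positivity)
    have h6 := (key y h1 h2).2.2.2
    linarith
  · rw [le_div_iff₀ (by positivity)]
    exact hc2 y (by linarith) (by linarith)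

theorem exists_eventually_pd_sub_le (hN : 2 ≤ N) (H : IsLocalApprox P f u u₀ R A L) (hB : 0 ≤ B)
    (hc : 0 ≤ c) (hΦ : ∀ᶠ ε in 𝓝[>] (0:ℝ), IsCapacitary P (Φ ε) ε c (μ ε) B)
    (hμ : Tendsto μ (𝓝[>] 0) (𝓝 0))
    (hμ' : Tendsto (fun ε => ε ^ (N - 1) / μ ε) (𝓝[>] 0) (𝓝 0)) :
    ∃ K, 0 ≤ K ∧ ∀ η > 0, ∀ᶠ ε in 𝓝[>] (0:ℝ), ∀ y, 8 * ε ≤ ‖y - P‖ → ‖y - P‖ ≤ R →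
      ∀ k, |pd (u ε) k y - pd u₀ k y| ≤ η + K * μ ε * (‖y - P‖ ^ (N - 1))⁻¹ := by
  have hL := H.lip_nonneg
  have hR := H.pos
  obtain ⟨D, hD, hgrad⟩ := exists_gradient_bound hN (by positivity : 0 < R / 4)
  set K : ℝ := D * (2 ^ (N - 2) + L * L) + L * c with hK
  have hK0 : 0 ≤ K := by positivity
  refine ⟨K, hK0, fun η hη => ?_⟩
  set θ : ℝ := min 1 (η / (D * (1 + L))) with hθ
  have hDL : 0 < D * (1 + L) := by positivity
  have hθ0 : 0 < θ := lt_min one_pos (by positivity)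
  have hθη : D * (1 + L) * θ ≤ η := by
    have := min_le_right 1 (η / (D * (1 + L)))
    rw [← hθ, le_div_iff₀ hDL] at this
    linarith
  have hsmall : ∀ᶠ ε in 𝓝[>] (0:ℝ), 512 * ε < R := by
    have := (tendsto_nhdsWithin_of_tendsto_nhds tendsto_id : Tendsto (fun ε : ℝ => ε) (𝓝[>] 0)
      (𝓝 0)).const_mul 512
    rw [mul_zero] at this
    exact this.eventually_lt_const hR
  filter_upwards [H.eventually_sol, hΦ, hsmall, H.eventually_near (R / 8) (by positivity) η hη,
    H.eventually_corrected_small hN hB hΦ hμ hμ' hθ0] with ε hs hcap e1 hnear hcor y h1 h2 k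
  have hε := hcap.pos
  have hμε := hcap.pos'
  have hq : 0 ≤ (‖y - P‖ ^ (N - 1))⁻¹ := by positivity
  rcases le_total (R / 8) ‖y - P‖ with h | h
  · have := (hnear y h h2).2 k
    have : 0 ≤ K * μ ε * (‖y - P‖ ^ (N - 1))⁻¹ := by positivity
    linarith
  · have hb := hgrad P y _ _ _ _ _ _ _ (H.annulusBounds hs hcap hθ0.le hcor.1 hcor.2 le_rfl
      (by norm_num) e1.le le_rfl le_rfl) (by linarith) (by linarith) k
    have a1 := (hs.contDiffAt y (by linarith) h2).differentiableAt (by norm_num)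
    have a2 := (H.limit_contDiffAt y h2).differentiableAt (by norm_num)
    have a3 := (hcap.contDiffAt y (hcap.ne_of_le (by linarith))).differentiableAt (by norm_num)
    have b1 : DifferentiableAt ℝ (fun y => u ε y - u₀ y) y := a1.sub a2
    have b2 : DifferentiableAt ℝ (fun y => u₀ P * Φ ε y) y := a3.const_mul _
    have e2 : pd (corrected P (u ε) u₀ (Φ ε)) k y
        = (pd (u ε) k y - pd u₀ k y) + u₀ P * pd (Φ ε) k y := by
      refine (pd_add b1 b2 k).trans ?_
      rw [pd_sub a1 a2, pd_const_mul a3]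
    have e3 : pd (u ε) k y - pd u₀ k y
        = pd (corrected P (u ε) u₀ (Φ ε)) k y - u₀ P * pd (Φ ε) k y := by rw [e2]; ring
    have e4 := mul_le_mul H.limit_le (hcap.abs_pd_le (by omega) hc (y := y) (by linarith) k)
      (abs_nonneg _) hL
    have e5 : θ * μ ε / ε ^ (N - 2) * (2 * ε) ^ (N - 2) = θ * (μ ε * 2 ^ (N - 2)) := by
      rw [mul_pow]
      field_simp
    have e6 : θ * (μ ε * 2 ^ (N - 2)) ≤ μ ε * 2 ^ (N - 2) :=
      mul_le_of_le_one_left (by positivity) (min_le_left _ _)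
    rw [e5] at hb
    have e7 := mul_le_mul_of_nonneg_left (mul_le_mul_of_nonneg_right e6 hq) hD.le
    rw [e3]
    refine (abs_sub _ _).trans ?_
    rw [abs_mul, abs_of_nonneg H.limit_nonneg, hK]
    linarith

theorem eventually_pd2_expansion (hN : 2 ≤ N) (H : IsLocalApprox P f u u₀ R A L) (hB : 0 ≤ B)
    (hc : 0 ≤ c) (hΦ : ∀ᶠ ε in 𝓝[>] (0:ℝ), IsCapacitary P (Φ ε) ε c (μ ε) B)
    (hμ : Tendsto μ (𝓝[>] 0) (𝓝 0))
    (hμ' : Tendsto (fun ε => ε ^ (N - 1) / μ ε) (𝓝[>] 0) (𝓝 0)) {δ : ℝ} (hδ : 0 < δ) :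
    ∃ r > 0, ∀ᶠ ε in 𝓝[>] (0:ℝ), ∀ x, 32 * ε ≤ ‖x - P‖ → ‖x - P‖ ≤ r → ∀ i j,
      |pd2 (u ε) i j x - pd2 u₀ i j x - u₀ P * (c * μ ε) *
          ((if i = j then 1 else 0) * (‖x - P‖ ^ N)⁻¹
            - N * (x i - P i) * (x j - P j) * (‖x - P‖ ^ (N + 2))⁻¹)|
        ≤ δ * (1 + μ ε * (‖x - P‖ ^ N)⁻¹) := by
  have hL := H.lip_nonneg
  have hA := H.bound_nonneg
  have hR := H.pos
  obtain ⟨K, hK, hpd⟩ := H.exists_eventually_pd_sub_le hN hB hc hΦ hμ hμ'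
  obtain ⟨D, hD, hhess⟩ := exists_hessian_bound hN (by positivity : 0 < R / 4)
  set E : ℝ := D * (1 + L + L * L + L * (2 * A) + 8 ^ (N - 2)) with hE
  have hE0 : 0 < E := by positivity
  set J : ℝ := L * L + L * K + L * L * L with hJ
  have hJ0 : 0 ≤ J := by positivity
  set θ : ℝ := δ / (2 * E) with hθ
  have hθ0 : 0 < θ := by positivity
  have hθδ : E * θ = δ / 2 := by rw [hθ]; field_simp
  set r : ℝ := min (R / 8) (δ / (2 * (D * J + 1))) with hr
  have hr0 : 0 < r := lt_min (by positivity) (by positivity)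
  have hrδ : D * J * r ≤ δ / 2 := by
    have h1 := min_le_right (R / 8) (δ / (2 * (D * J + 1)))
    rw [← hr, le_div_iff₀ (by positivity)] at h1
    linarith
  have hsmall : ∀ᶠ ε in 𝓝[>] (0:ℝ), 512 * ε < R := by
    have := (tendsto_nhdsWithin_of_tendsto_nhds tendsto_id : Tendsto (fun ε : ℝ => ε) (𝓝[>] 0)
      (𝓝 0)).const_mul 512
    rw [mul_zero] at this
    exact this.eventually_lt_const hR
  have hsmall' : ∀ᶠ ε in 𝓝[>] (0:ℝ), 8 ^ (N - 1) * (ε ^ (N - 1) / μ ε) < θ := by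
    have := hμ'.const_mul (8 ^ (N - 1))
    rw [mul_zero] at this
    exact this.eventually_lt_const hθ0
  refine ⟨r, hr0, ?_⟩
  filter_upwards [H.eventually_sol, hΦ, hsmall, hsmall', hpd θ hθ0,
    H.eventually_corrected_small hN hB hΦ hμ hμ' hθ0] with ε hs hcap e1 e2 hp hcor x h1 h2 i j
  have hε := hcap.pos
  have hμε := hcap.pos'
  have hxR : ‖x - P‖ ≤ R / 8 := h2.trans (min_le_left _ _)
  have hx0 : 0 < ‖x - P‖ := by linarith
  have hGM : ∀ y, 8 * ε ≤ ‖y - P‖ → ‖y - P‖ ≤ 2 * (8 * ε) →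
      |f (u₀ y) - f (u ε y)| ≤ L * (2 * A) := fun y g1 g2 => by
    have s1 := hs.abs_le y (by linarith) (by linarith)
    have s2 := H.limit_abs_le y (by linarith)
    refine (H.corrected_pde hs hcap (y := y) (by linarith) (by linarith)).2.2.2.trans
      (mul_le_mul_of_nonneg_left ((abs_sub _ _).trans ?_) hL)
    linarith
  have hGd : ∀ k y, 8 * ε ≤ ‖y - P‖ → ‖y - P‖ ≤ 2 * (R / 4) →
      |pd (fun y => f (u₀ y) - f (u ε y)) k y|
        ≤ (L + L * L) * θ + J * μ ε * (‖y - P‖ ^ (N - 1))⁻¹ := fun k y g1 g2 => by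
    have s1 := mul_le_mul_of_nonneg_left (hp y g1 (by linarith) k) hL
    have s2 := mul_le_mul_of_nonneg_left (H.abs_sub_le_of_corrected hcap (y := y) (by linarith)
      (by linarith) (hcor.1 y (by linarith) (by linarith))) (mul_nonneg hL hL)
    have s3 := H.pd_rhs_le hs (y := y) (by linarith) (by linarith) k
    have s4 : 0 ≤ L * L * μ ε * (‖y - P‖ ^ (N - 1))⁻¹ := by positivity
    rw [hJ]
    linarith
  have hη₃ : L * θ ≤ (L + L * L) * θ := by
    have : 0 ≤ L * L * θ := by positivity
    linarith
  have hm' : L * L * μ ε ≤ J * μ ε := by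
    have : 0 ≤ (L * K + L * L * L) * μ ε := by positivity
    rw [hJ]
    linarith
  have hb := hhess P x _ _ _ _ _ _ _ (L * (2 * A)) (H.annulusBounds hs hcap hθ0.le hcor.1 hcor.2
      (by norm_num : (2:ℝ) ≤ 8) (by norm_num) e1.le hη₃ hm')
      (by positivity) hGM hGd (by linarith) (by linarith) j i
  have a1 := hs.contDiffAt x (by linarith) (by linarith)
  have a2 := H.limit_contDiffAt x (by linarith)
  have a3 := hcap.contDiffAt x (hcap.ne_of_le (by linarith))
  have b1 : ContDiffAt ℝ 2 (fun y => u ε y - u₀ y) x := a1.sub a2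
  have b2 : ContDiffAt ℝ 2 (fun y => u₀ P * Φ ε y) x := contDiffAt_const.mul a3
  have e3 : pd2 (corrected P (u ε) u₀ (Φ ε)) i j x
      = pd2 (u ε) i j x - pd2 u₀ i j x - u₀ P * (c * μ ε) *
          ((if i = j then 1 else 0) * (‖x - P‖ ^ N)⁻¹
            - N * (x i - P i) * (x j - P j) * (‖x - P‖ ^ (N + 2))⁻¹) := by
    refine (pd2_add b1 b2 i j).trans ?_
    rw [pd2_sub a1 a2, pd2_const_mul a3, hcap.pd2_eq (hcap.ne_of_le (by linarith))]
    ring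
  rw [← e3]
  refine hb.trans ?_
  have hQ : 0 ≤ (‖x - P‖ ^ N)⁻¹ := by positivity
  set Q := (‖x - P‖ ^ N)⁻¹ with hQdef
  have hq : (‖x - P‖ ^ (N - 1))⁻¹ = ‖x - P‖ * Q := by
    obtain ⟨n, rfl⟩ : ∃ n, N = n + 1 := ⟨N - 1, by omega⟩
    rw [hQdef, Nat.add_sub_cancel, pow_succ]
    field_simp
  have hx1 : ‖x - P‖ ≤ 1 := by linarith [H.le_one]
  have e5 : θ * μ ε / ε ^ (N - 2) * (8 * ε) ^ (N - 2) = θ * μ ε * 8 ^ (N - 2) := by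
    rw [mul_pow]
    field_simp
  have e6 : (8 * ε) ^ (N - 1) ≤ θ * μ ε := by
    rw [← mul_div_assoc, div_lt_iff₀ hμε, ← mul_pow] at e2
    exact e2.le
  rw [e5, hq]
  have t1 : L * (2 * A) * (8 * ε) ^ (N - 1) * (‖x - P‖ * Q) ≤ L * (2 * A) * (θ * μ ε) * Q := by
    have := mul_le_mul_of_nonneg_left e6 (by positivity : 0 ≤ L * (2 * A))
    exact mul_le_mul this (mul_le_of_le_one_left hQ hx1) (by positivity) (by positivity)
  have t2 : D * (J * μ ε * (‖x - P‖ * Q)) ≤ δ / 2 * (μ ε * Q) := by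
    have := mul_le_mul_of_nonneg_left h2 (by positivity : 0 ≤ D * J)
    have := mul_le_mul_of_nonneg_right (this.trans hrδ) (by positivity : 0 ≤ μ ε * Q)
    linarith
  have t3 : D * (θ + (L + L * L) * θ) ≤ δ / 2 := by
    rw [← hθδ, hE]
    have : 0 ≤ D * (L * (2 * A) + 8 ^ (N - 2)) * θ := by positivity
    linarith
  have t4 : D * (L * (2 * A) * (θ * μ ε) * Q + θ * μ ε * 8 ^ (N - 2) * Q)
      ≤ δ / 2 * (μ ε * Q) := by
    rw [← hθδ, hE]
    have : 0 ≤ D * (1 + L + L * L) * θ * (μ ε * Q) := by positivity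
    linarith
  have t5 := mul_le_mul_of_nonneg_left t1 hD.le
  linarith

end IsLocalApprox

end Perturbation

section Localization

variable {N : ℕ} {P : EN N}

theorem mem_closure_diff_closedBall {Ω : Set (EN N)} {ε R : ℝ} (hε : 0 < ε) (hεR : ε < R)
    (hR : closedBall P R ⊆ Ω) {y : EN N} (h1 : ε ≤ ‖y - P‖) (h2 : ‖y - P‖ ≤ R) :
    y ∈ closure (Ω \ closedBall P ε) := by
  rcases h1.lt_or_eq with h | h
  · refine subset_closure ⟨hR (by rwa [mem_closedBall, dist_eq_norm]), ?_⟩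
    rw [mem_closedBall, dist_eq_norm]
    exact h.not_ge
  · have ht : Tendsto (fun t : ℝ => P + t • (y - P)) (𝓝[>] 1) (𝓝 y) := by
      have h0 : Continuous fun t : ℝ => P + t • (y - P) := by fun_prop
      have h3 := h0.tendsto 1
      rw [one_smul, add_sub_cancel] at h3
      exact h3.mono_left nhdsWithin_le_nhds
    have h4 : (1:ℝ) < R / ε := (one_lt_div hε).2 hεR
    refine mem_closure_of_tendsto ht ?_
    filter_upwards [Ioo_mem_nhdsGT h4] with t ht
    have hn : ‖P + t • (y - P) - P‖ = t * ε := by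
      rw [add_sub_cancel_left, norm_smul, ← h, Real.norm_of_nonneg (by linarith [ht.1])]
    refine ⟨hR ?_, ?_⟩
    · rw [mem_closedBall, dist_eq_norm, hn]
      exact ((lt_div_iff₀ hε).1 ht.2).le
    · rw [mem_closedBall, dist_eq_norm, hn, not_le]
      exact lt_mul_of_one_lt_left hε ht.1

theorem IsSol.isLocalSol {Ω : Set (EN N)} {f : ℝ → ℝ} {v : EN N → ℝ} {ε R A : ℝ}
    (H : IsSol f (Ω \ closedBall P ε) v) (hΩ : IsOpen Ω) (hε : 0 < ε) (hεR : ε < R)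
    (hR : closedBall P R ⊆ Ω) (hA : ∀ x ∈ Ω \ closedBall P ε, |v x| ≤ A) :
    IsLocalSol P f v ε R A := by
  have ho : IsOpen (Ω \ closedBall P ε) := hΩ.sdiff isClosed_closedBall
  have hmem : ∀ y, ε < ‖y - P‖ → ‖y - P‖ ≤ R → y ∈ Ω \ closedBall P ε := fun y h1 h2 => by
    refine ⟨hR (by rwa [mem_closedBall, dist_eq_norm]), ?_⟩
    rw [mem_closedBall, dist_eq_norm]
    exact h1.not_ge
  obtain ⟨s1, s2, -, s4, s5⟩ := H
  refine ⟨fun y h1 h2 => s1.contDiffAt (ho.mem_nhds (hmem y h1 h2)),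
    fun y h1 h2 => s2 y (hmem y h1 h2), fun y h1 h2 => hA y (hmem y h1 h2),
    s4.mono fun y hy => mem_closure_diff_closedBall hε hεR hR hy.1 hy.2, fun y hy => s5 y ?_⟩
  rw [ho.frontier_eq]
  refine ⟨mem_closure_diff_closedBall hε hεR hR hy.ge (hy.le.trans hεR.le), fun h => h.2 ?_⟩
  rw [mem_closedBall, dist_eq_norm, hy]

theorem Setting.exists_isLocalApprox {Ω : Set (EN N)} {f : ℝ → ℝ} {ε₀ C : ℝ}
    {u : ℝ → EN N → ℝ} {u₀ : EN N → ℝ} (H : Setting Ω P f ε₀ C u u₀) :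
    ∃ R A L, IsLocalApprox P f u u₀ R A L := by
  obtain ⟨hΩ, -, hP, hf, hε₀, hsol, hC, ⟨h0c, h0l, h0p, -, -⟩, hconv⟩ := H
  obtain ⟨s, hs, hsΩ⟩ := Metric.isOpen_iff.1 hΩ P hP
  set R : ℝ := min (s / 2) 1 with hRdef
  have hR : 0 < R := lt_min (by positivity) one_pos
  have hRΩ : closedBall P R ⊆ Ω := (closedBall_subset_ball
    ((min_le_left _ _).trans_lt (by linarith))).trans hsΩ
  have hmem : ∀ y, ‖y - P‖ ≤ R → y ∈ Ω := fun y hy =>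
    hRΩ (by rwa [mem_closedBall, dist_eq_norm])
  have hcd : ∀ y, ‖y - P‖ ≤ R → ContDiffAt ℝ 2 u₀ y := fun y hy =>
    h0c.contDiffAt (hΩ.mem_nhds (hmem y hy))
  have hball : ∀ y ∈ closedBall P R, ‖y - P‖ ≤ R := fun y hy => by
    rwa [mem_closedBall, dist_eq_norm] at hy
  have hcomp : IsCompact (closedBall P R) := isCompact_closedBall P R
  have hPmem : P ∈ closedBall P R := mem_closedBall_self hR.le
  obtain ⟨A₀, hA₀⟩ := hcomp.exists_bound_of_continuousOn (h0c.continuousOn.mono hRΩ)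
  obtain ⟨L₀, hL₀⟩ := hcomp.exists_bound_of_continuousOn (f := fderiv ℝ u₀) fun y hy =>
    (((hcd y (hball y hy)).fderiv_right (m := 1) (by norm_num)).continuousAt).continuousWithinAt
  have hA₀0 : 0 ≤ A₀ := (norm_nonneg _).trans (hA₀ P hPmem)
  have hL₀0 : 0 ≤ L₀ := (norm_nonneg _).trans (hL₀ P hPmem)
  set A : ℝ := max C A₀ with hA
  have hA0 : 0 ≤ A := hA₀0.trans (le_max_right _ _)
  have hf2 : ContDiff ℝ 2 f := contDiff_infty.1 hf 2
  have hf1 : ContDiff ℝ 1 (deriv f) := by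
    refine ContDiff.deriv' ?_
    rwa [one_add_one_eq_two]
  have hIcc : ∀ t, |t| ≤ A → t ∈ Icc (-A) A := fun t ht => abs_le.1 ht
  have h0mem : (0:ℝ) ∈ Icc (-A) A := ⟨by linarith, hA0⟩
  obtain ⟨L₁, hL₁⟩ := (isCompact_Icc (a := -A) (b := A)).exists_bound_of_continuousOn
    hf1.continuous.continuousOn
  obtain ⟨L₂, hL₂⟩ := (isCompact_Icc (a := -A) (b := A)).exists_bound_of_continuousOn
    (hf1.continuous_deriv le_rfl).continuousOn
  have hL₁0 : 0 ≤ L₁ := (norm_nonneg _).trans (hL₁ 0 h0mem)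
  have hL₂0 : 0 ≤ L₂ := (norm_nonneg _).trans (hL₂ 0 h0mem)
  have mv : ∀ (g : ℝ → ℝ) (D : ℝ), Differentiable ℝ g → (∀ t ∈ Icc (-A) A, ‖deriv g t‖ ≤ D) →
      ∀ s t, |s| ≤ A → |t| ≤ A → |g s - g t| ≤ D * |s - t| := fun g D hg hD s t hs ht =>
    (convex_Icc (-A) A).norm_image_sub_le_of_norm_deriv_le (fun x _ => hg x) hD (hIcc t ht)
      (hIcc s hs)
  refine ⟨R, A, L₀ + L₁ + L₂ + A, hR, min_le_right _ _, hA0, by positivity, hf2,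
    fun s t hs ht => ?_, fun s hs => (hL₁ s (hIcc s hs)).trans (by linarith),
    fun s t hs ht => ?_, hcd, fun y hy => h0l y (hmem y hy), fun y hy => ?_, fun y hy k => ?_,
    fun y hy => ?_, (h0p P hP).le, ?_, ?_, fun r hr η hη => ?_⟩
  · refine (mv f L₁ (hf2.differentiable (by norm_num)) hL₁ s t hs ht).trans ?_
    exact mul_le_mul_of_nonneg_right (by linarith) (abs_nonneg _)
  · refine (mv (deriv f) L₂ (hf1.differentiable (by norm_num)) hL₂ s t hs ht).trans ?_
    exact mul_le_mul_of_nonneg_right (by linarith) (abs_nonneg _)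
  · exact (hA₀ y (by rwa [mem_closedBall, dist_eq_norm])).trans (le_max_right _ _)
  · refine (abs_pd_le _ _ _).trans ((hL₀ y (by rwa [mem_closedBall, dist_eq_norm])).trans ?_)
    linarith
  · have := (convex_closedBall P R).norm_image_sub_le_of_norm_fderiv_le (𝕜 := ℝ)
      (fun z hz => (hcd z (hball z hz)).differentiableAt (by norm_num)) hL₀
      (by rwa [mem_closedBall, dist_eq_norm] : y ∈ closedBall P R) hPmem
    rw [norm_sub_rev P y] at this
    refine this.trans (mul_le_mul_of_nonneg_right (by linarith) (norm_nonneg _))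
  · have h1 := (le_abs_self (u₀ P)).trans (hA₀ P hPmem)
    have h2 : A₀ ≤ A := le_max_right _ _
    linarith
  · filter_upwards [Ioo_mem_nhdsGT (lt_min hε₀ hR)] with ε hε
    have h1 : ε ∈ Ioo 0 ε₀ := ⟨hε.1, hε.2.trans_le (min_le_left _ _)⟩
    exact (hsol ε h1).isLocalSol hΩ hε.1 (hε.2.trans_le (min_le_right _ _)) hRΩ
      fun x hx => (hC ε h1 x hx).trans (le_max_left _ _)
  · obtain ⟨c1, c2, -⟩ := hconv {y | r ≤ ‖y - P‖ ∧ ‖y - P‖ ≤ R} (fun y hy => ⟨hmem y hy.2, by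
      rintro rfl
      have := hy.1
      rw [sub_self, norm_zero] at this
      linarith⟩) (isCompact_annulus P r R)
    have c2' : ∀ᶠ ε in 𝓝[>] (0:ℝ), ∀ k, ∀ y ∈ {y | r ≤ ‖y - P‖ ∧ ‖y - P‖ ≤ R},
        dist (pd u₀ k y) (pd (u ε) k y) < η :=
      eventually_all.2 fun k => Metric.tendstoUniformlyOn_iff.1 (c2 k) η hη
    filter_upwards [Metric.tendstoUniformlyOn_iff.1 c1 η hη, c2'] with ε e1 e2 y h1 h2
    refine ⟨?_, fun k => ?_⟩
    · have := (e1 y ⟨h1, h2⟩).le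
      rwa [dist_comm, Real.dist_eq] at this
    · have := (e2 k y ⟨h1, h2⟩).le
      rwa [dist_comm, Real.dist_eq] at this

end Localization

section Expansion

theorem tendsto_nhdsGT_zero_id : Tendsto (fun ε : ℝ => ε) (𝓝[>] 0) (𝓝 0) :=
  tendsto_nhdsWithin_of_tendsto_nhds tendsto_id

theorem eventually_mul_le_of_rpow_le {C₁ β : ℝ} (hC₁ : 0 < C₁) (hβ : β < 1) (k : ℝ) :
    ∀ᶠ ε in 𝓝[>] (0:ℝ), k * ε ≤ C₁ * ε ^ β := by
  have h1 : Tendsto (fun ε : ℝ => k * ε ^ (1 - β)) (𝓝[>] 0) (𝓝 0) := by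
    have h := (Real.continuousAt_rpow_const 0 (1 - β) (Or.inr (by linarith))).tendsto
    rw [Real.zero_rpow (by linarith)] at h
    have := (h.mono_left (nhdsWithin_le_nhds (s := Ioi 0))).const_mul k
    rwa [mul_zero] at this
  filter_upwards [h1.eventually_lt_const hC₁, self_mem_nhdsWithin] with ε h hε
  have hε : 0 < ε := hε
  have e : ε = ε ^ (1 - β) * ε ^ β := by
    rw [← Real.rpow_add hε, sub_add_cancel, Real.rpow_one]
  have := mul_le_mul_of_nonneg_right h.le (Real.rpow_nonneg hε.le β)
  calc k * ε = k * ε ^ (1 - β) * ε ^ β := by rw [mul_assoc, ← e]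
    _ ≤ _ := this

theorem tendsto_abs_log_nhdsGT_zero : Tendsto (fun ε : ℝ => |Real.log ε|) (𝓝[>] 0) atTop :=
  tendsto_abs_atBot_atTop.comp Real.tendsto_log_nhdsGT_zero

theorem tendsto_mul_abs_log_rpow (d : ℝ) :
    Tendsto (fun ε : ℝ => ε * |Real.log ε| ^ d) (𝓝[>] 0) (𝓝 0) := by
  have h := (tendsto_rpow_mul_exp_neg_mul_atTop_nhds_zero d 1 one_pos).comp
    tendsto_abs_log_nhdsGT_zero
  refine h.congr' ?_
  filter_upwards [Ioo_mem_nhdsGT one_pos] with ε hε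
  simp only [Function.comp]
  rw [abs_of_neg (Real.log_neg hε.1 hε.2), neg_one_mul, neg_neg, Real.exp_log hε.1, mul_comm]

theorem tendsto_div_abs_log_rpow (k : ℝ) {d : ℝ} (hd : 0 < d) :
    Tendsto (fun ε : ℝ => k / |Real.log ε| ^ d) (𝓝[>] 0) (𝓝 0) :=
  ((tendsto_rpow_atTop hd).comp tendsto_abs_log_nhdsGT_zero).const_div_atTop k

theorem eventually_mul_le_div_abs_log_rpow {C₁ : ℝ} (hC₁ : 0 < C₁) (d k : ℝ) :
    ∀ᶠ ε in 𝓝[>] (0:ℝ), k * ε ≤ C₁ / |Real.log ε| ^ d := by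
  have h := (tendsto_mul_abs_log_rpow d).const_mul k
  rw [mul_zero] at h
  filter_upwards [h.eventually_lt_const hC₁,
    tendsto_abs_log_nhdsGT_zero.eventually_gt_atTop 0] with ε h1 h2
  rw [le_div_iff₀ (Real.rpow_pos_of_pos h2 d)]
  linarith

end Expansion

/-- Proposition 4.9 of the paper: the expansion of the second derivatives of
`u ε`.  (1) For `N ≥ 3`, along families `x ε` with `C₁ε^β ≤ |x ε - P| ≤ C₂ε^β`,
`β ∈ (0,(N-1)/N)`:  `∂²u_ε = ∂²u₀ + o(1) +
((N-2)u₀(P)ε^{N-2}/|x-P|^N)(δ_ij - N(x_i-P_i)(x_j-P_j)/|x-P|² + o(1))`.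
(2) For `N = 2`, along families with `C₁/|log ε|^d ≤ |x ε - P| ≤ C₂/|log ε|^d`:
`∂²u_ε = ∂²u₀ + o(1) + (u₀(P)/(|log ε||x-P|²))(δ_ij - 2(x_i-P_i)(x_j-P_j)/|x-P|²
+ o(1/|x-P|))`. -/
theorem stmt17
    {N : ℕ} (hN : 2 ≤ N)
    (Ω : Set (EN N)) (P : EN N) (f : ℝ → ℝ) (ε₀ C : ℝ)
    (u : ℝ → EN N → ℝ) (u₀ : EN N → ℝ)
    (hset : Setting Ω P f ε₀ C u u₀) :
    (3 ≤ N → ∀ C₁ C₂ β : ℝ, 0 < C₁ → 0 < C₂ → 0 < β → β < ((N:ℝ) - 1)/(N:ℝ) →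
      ∀ x : ℝ → EN N,
        (∀ᶠ ε in 𝓝[>] (0:ℝ), x ε ∈ Ω \ closedBall P ε ∧
          C₁ * ε ^ β ≤ ‖x ε - P‖ ∧ ‖x ε - P‖ ≤ C₂ * ε ^ β) →
        ∀ δ > (0:ℝ), ∀ᶠ ε in 𝓝[>] (0:ℝ), ∀ i j : Fin N,
          |pd2 (u ε) i j (x ε) - pd2 u₀ i j (x ε)
              - ((N:ℝ) - 2) * u₀ P * ε ^ (N - 2) / ‖x ε - P‖ ^ N
                * ((if i = j then (1:ℝ) else 0)
                    - (N:ℝ) * (x ε i - P i) * (x ε j - P j) / ‖x ε - P‖ ^ 2)|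
            ≤ δ * (1 + ε ^ (N - 2) / ‖x ε - P‖ ^ N)) ∧
    (N = 2 → ∀ C₁ C₂ d : ℝ, 0 < C₁ → 0 < C₂ → 0 < d →
      ∀ x : ℝ → EN N,
        (∀ᶠ ε in 𝓝[>] (0:ℝ), x ε ∈ Ω \ closedBall P ε ∧
          C₁ / |Real.log ε| ^ d ≤ ‖x ε - P‖ ∧ ‖x ε - P‖ ≤ C₂ / |Real.log ε| ^ d) →
        ∀ δ > (0:ℝ), ∀ᶠ ε in 𝓝[>] (0:ℝ), ∀ i j : Fin N,
          |pd2 (u ε) i j (x ε) - pd2 u₀ i j (x ε)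
              - u₀ P / (|Real.log ε| * ‖x ε - P‖ ^ 2)
                * ((if i = j then (1:ℝ) else 0)
                    - 2 * (x ε i - P i) * (x ε j - P j) / ‖x ε - P‖ ^ 2)|
            ≤ δ * (1 + 1 / (|Real.log ε| * ‖x ε - P‖ ^ 3))) := by
  obtain ⟨R, A, L, H⟩ := hset.exists_isLocalApprox
  refine ⟨fun hN3 C₁ C₂ β hC₁ hC₂ hβ hβ' x hx δ hδ => ?_, ?_⟩
  · have hβ1 : β < 1 := hβ'.trans_le (by
      rw [div_le_one (by positivity)]
      linarith)
    have hc : (0:ℝ) ≤ (N:ℝ) - 2 := by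
      have : (2:ℝ) ≤ N := by exact_mod_cast hN
      linarith
    have hΦ : ∀ᶠ ε in 𝓝[>] (0:ℝ), IsCapacitary P (fun y => ε ^ (N - 2) * (‖y - P‖ ^ (N - 2))⁻¹)
        ε ((N : ℝ) - 2) (ε ^ (N - 2)) 1 := by
      filter_upwards [self_mem_nhdsWithin] with ε hε using isCapacitary_pow hN3 P hε
    have hμ : Tendsto (fun ε : ℝ => ε ^ (N - 2)) (𝓝[>] 0) (𝓝 0) := by
      have := tendsto_nhdsGT_zero_id.pow (N - 2)
      rwa [zero_pow (by omega)] at this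
    have hμ' : Tendsto (fun ε : ℝ => ε ^ (N - 1) / ε ^ (N - 2)) (𝓝[>] 0) (𝓝 0) := by
      refine tendsto_nhdsGT_zero_id.congr' ?_
      filter_upwards [self_mem_nhdsWithin] with ε hε
      have hε : 0 < ε := hε
      rw [show N - 1 = N - 2 + 1 by omega, pow_succ]
      field_simp
    obtain ⟨r, hr, hexp⟩ := H.eventually_pd2_expansion hN zero_le_one hc hΦ hμ hμ' hδ
    have hsmall : ∀ᶠ ε in 𝓝[>] (0:ℝ), C₂ * ε ^ β < r := by
      have h := (Real.continuousAt_rpow_const 0 β (Or.inr hβ.le)).tendsto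
      rw [Real.zero_rpow hβ.ne'] at h
      have h' := (h.mono_left (nhdsWithin_le_nhds (s := Ioi 0))).const_mul C₂
      rw [mul_zero] at h'
      exact h'.eventually_lt_const hr
    filter_upwards [hx, hexp, hsmall, eventually_mul_le_of_rpow_le hC₁ hβ1 32,
      self_mem_nhdsWithin] with ε h1 h2 h3 h4 h5 i j
    have h5 : 0 < ε := h5
    have h6 := h4.trans h1.2.1
    have h7 : 0 < ‖x ε - P‖ := by linarith
    refine le_trans (le_of_eq ?_) ((h2 (x ε) h6 (h1.2.2.trans h3.le) i j).trans_eq ?_)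
    · congr 2
      rw [pow_add]
      field_simp
    · rw [div_eq_mul_inv]
  · rintro rfl C₁ C₂ d hC₁ hC₂ hd x hx δ hδ
    have hΦ : ∀ᶠ ε in 𝓝[>] (0:ℝ), IsCapacitary P (fun y => (Real.log ε)⁻¹ * Real.log ‖y - P‖)
        ε 1 |Real.log ε|⁻¹ (Real.log 32) := by
      filter_upwards [Ioo_mem_nhdsGT one_pos] with ε hε using isCapacitary_log P hε.1 hε.2
    have hμ' : Tendsto (fun ε : ℝ => ε ^ (2 - 1) / |Real.log ε|⁻¹) (𝓝[>] 0) (𝓝 0) := by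
      simpa using tendsto_mul_abs_log_rpow 1
    obtain ⟨r, hr, hexp⟩ := H.eventually_pd2_expansion hN (Real.log_nonneg (by norm_num))
      zero_le_one hΦ tendsto_abs_log_nhdsGT_zero.inv_tendsto_atTop hμ' hδ
    filter_upwards [hx, hexp, (tendsto_div_abs_log_rpow C₂ hd).eventually_lt_const
      (lt_min hr one_pos), eventually_mul_le_div_abs_log_rpow hC₁ d 32,
      Ioo_mem_nhdsGT one_pos] with ε h1 h2 h3 h4 h5 i j
    have h6 := h4.trans h1.2.1
    have h7 : 0 < ‖x ε - P‖ := by linarith [h5.1]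
    have h8 := h1.2.2.trans (h3.le.trans (min_le_right _ _))
    have h9 := h2 (x ε) h6 (h1.2.2.trans (h3.le.trans (min_le_left _ _))) i j
    have h10 : 0 < |Real.log ε| := abs_pos.2 (Real.log_neg h5.1 h5.2).ne
    refine le_trans (le_of_eq ?_) (h9.trans (mul_le_mul_of_nonneg_left ?_ hδ.le))
    · congr 2
      push_cast
      field_simp
    · rw [one_div, mul_inv]
      gcongr 1 + _ * ?_
      exact inv_anti₀ (by positivity) (pow_le_pow_of_le_one h7.le h8 (by norm_num))
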